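/- For the specific binary-input ternary-output channel W and decoding metric q given below, the mismatched capacity strictly exceeds the optimized LM rate. Concretely: (i) for every δ > 0 and every ε > 0, for all sufficiently large n there exists a codebook {x^(1),…,x^(M)} ⊆ {0,1}^n with M ≥ exp(n(0.137998 − δ)) whose error probability p_e under the maximum-q-metric decoder (with ties counted as errors) satisfies p_e ≤ ε; and (ii) for every input distribution Q on {0,1}, the primal LM rate satisfies I_LM(Q) ≤ 0.1369. In particular, the mismatched capacity C_M of (W,q) satisfies C_M ≥ 0.137998 > 0.1369 ≥ sup_Q I_LM(Q). -/

import Mathlib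

open scoped BigOperators

/-- The channel `W(y|x)` of the counter-example. -/
noncomputable def W : Fin 2 → Fin 3 → ℝ := ![![0.97, 0.03, 0], ![0.1, 0.1, 0.8]]

/-- The decoding metric `q(x,y)` of the counter-example. -/
noncomputable def q : Fin 2 → Fin 3 → ℝ := ![![1, 1, 1], ![1, 0.5, 1.36]]

/-- The `n`-letter memoryless channel `W^n(y|x)`. -/
noncomputable def Wn (n : ℕ) (x : Fin n → Fin 2) (y : Fin n → Fin 3) : ℝ :=
  ∏ i, W (x i) (y i)

/-- The `n`-letter product decoding metric `q^n(x,y)`. -/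
noncomputable def qn (n : ℕ) (x : Fin n → Fin 2) (y : Fin n → Fin 3) : ℝ :=
  ∏ i, q (x i) (y i)

/-- Error probability of codebook `c` under maximum-metric decoding,
uniform message, ties broken as errors. -/
noncomputable def pe (n M : ℕ) (c : Fin M → Fin n → Fin 2) : ℝ :=
  (1 / (M : ℝ)) * ∑ m : Fin M, ∑ y : Fin n → Fin 3,
    Wn n (c m) y * (if ∃ j : Fin M, j ≠ m ∧ qn n (c m) y ≤ qn n (c j) y then 1 else 0)

/-- Output distribution induced by input distribution `Q`. -/
noncomputable def PY (Q : Fin 2 → ℝ) (y : Fin 3) : ℝ := ∑ x, Q x * W x y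

/-- The primal LM rate `I_LM(Q)`. -/
noncomputable def ILM (Q : Fin 2 → ℝ) : ℝ :=
  sInf { r : ℝ | ∃ P : Fin 2 → Fin 3 → ℝ,
    (∀ x y, 0 ≤ P x y) ∧
    (∀ x, ∑ y, P x y = Q x) ∧
    (∀ y, ∑ x, P x y = PY Q y) ∧
    (∑ x, ∑ y, Q x * W x y * Real.log (q x y)) ≤ (∑ x, ∑ y, P x y * Real.log (q x y)) ∧
    r = ∑ x, ∑ y, P x y * Real.log (P x y / ((∑ y', P x y') * (∑ x', P x' y))) }

/-- The mutual information of a joint weight function `P`. -/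
noncomputable def jointInfo (P : Fin 2 → Fin 3 → ℝ) : ℝ :=
  ∑ x, ∑ y, P x y * Real.log (P x y / ((∑ y', P x y') * (∑ x', P x' y)))

/-- A feasible `P` of mutual information at most `b ≥ 0` bounds the LM rate by `b`. -/
theorem ILM_le_of_feasible {Q : Fin 2 → ℝ} {b : ℝ} (hb : 0 ≤ b) (P : Fin 2 → Fin 3 → ℝ)
    (hP : ∀ x y, 0 ≤ P x y) (hX : ∀ x, ∑ y, P x y = Q x) (hY : ∀ y, ∑ x, P x y = PY Q y)
    (hq : (∑ x, ∑ y, Q x * W x y * Real.log (q x y)) ≤ ∑ x, ∑ y, P x y * Real.log (q x y))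
    (hI : jointInfo P ≤ b) : ILM Q ≤ b := by
  unfold ILM
  by_cases h : BddBelow { r : ℝ | ∃ P : Fin 2 → Fin 3 → ℝ,
    (∀ x y, 0 ≤ P x y) ∧
    (∀ x, ∑ y, P x y = Q x) ∧
    (∀ y, ∑ x, P x y = PY Q y) ∧
    (∑ x, ∑ y, Q x * W x y * Real.log (q x y)) ≤ (∑ x, ∑ y, P x y * Real.log (q x y)) ∧
    r = ∑ x, ∑ y, P x y * Real.log (P x y / ((∑ y', P x y') * (∑ x', P x' y))) }
  · exact (csInf_le h ⟨P, hP, hX, hY, hq, rfl⟩).trans hI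
  · rw [Real.sInf_of_not_bddBelow h]
    exact hb

theorem le_log_of_mul_two_pow {r x : ℝ} (k n : ℕ) (h0 : 0 ≤ x) (h1 : x < 1)
    (hr : r * 2 ^ k = (1 + x) / (1 - x)) :
    2 * ∑ i ∈ Finset.range n, x ^ (2 * i + 1) / (2 * i + 1) - k * Real.log 2 ≤ Real.log r := by
  have h := Real.sum_range_le_log_div h0 h1 n
  have hpos : 0 < r * 2 ^ k := hr ▸ div_pos (by linarith) (by linarith)
  have hrpos : 0 < r := pos_of_mul_pos_left hpos (by positivity)
  rw [← hr, Real.log_mul hrpos.ne' (by positivity), Real.log_pow] at h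
  linarith

theorem log_le_of_mul_two_pow {r x : ℝ} (k n : ℕ) (h0 : 0 ≤ x) (h1 : x < 1)
    (hr : r * 2 ^ k = (1 + x) / (1 - x)) :
    Real.log r ≤ 2 * (∑ i ∈ Finset.range n, x ^ (2 * i + 1) / (2 * i + 1)
      + x ^ (2 * n + 1) / (1 - x ^ 2)) - k * Real.log 2 := by
  have h := Real.log_div_le_sum_range_add h0 h1 n
  have hpos : 0 < r * 2 ^ k := hr ▸ div_pos (by linarith) (by linarith)
  have hrpos : 0 < r := pos_of_mul_pos_left hpos (by positivity)
  rw [← hr, Real.log_mul hrpos.ne' (by positivity), Real.log_pow] at h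
  linarith

theorem log_bounds {r x lo hi : ℝ} (k n : ℕ) (h0 : 0 ≤ x) (h1 : x < 1)
    (hr : r * 2 ^ k = (1 + x) / (1 - x))
    (hlo : lo ≤ 2 * ∑ i ∈ Finset.range n, x ^ (2 * i + 1) / (2 * i + 1) - k * 0.6931471808)
    (hhi : 2 * (∑ i ∈ Finset.range n, x ^ (2 * i + 1) / (2 * i + 1)
      + x ^ (2 * n + 1) / (1 - x ^ 2)) - k * 0.6931471803 ≤ hi) :
    lo ≤ Real.log r ∧ Real.log r ≤ hi := by
  have hl := le_log_of_mul_two_pow k n h0 h1 hr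
  have hh := log_le_of_mul_two_pow k n h0 h1 hr
  have hk : (0 : ℝ) ≤ k := Nat.cast_nonneg k
  have h2 := mul_le_mul_of_nonneg_left Real.log_two_gt_d9.le hk
  have h3 := mul_le_mul_of_nonneg_left Real.log_two_lt_d9.le hk
  constructor <;> linarith

theorem log_tau_compl_bounds : (-0.85467838 : ℝ) ≤ Real.log 0.42542 ∧ Real.log 0.42542 ≤ -0.85467835 := by
  apply log_bounds (x := 8771 / 33771) 2 8 <;> norm_num [Finset.sum_range_succ]

theorem log_tau_bounds : (-0.55411595 : ℝ) ≤ Real.log 0.57458 ∧ Real.log 0.57458 ≤ -0.55411592 := by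
  apply log_bounds (x := 3729 / 53729) 1 8 <;> norm_num [Finset.sum_range_succ]

theorem log_alpha_bounds : (-1.48978997 : ℝ) ≤ Real.log 0.22542 ∧ Real.log 0.22542 ≤ -1.48978994 := by
  apply log_bounds (x := 5021 / 17521) 3 8 <;> norm_num [Finset.sum_range_succ]

theorem log_four_fifths_bounds : (-0.22314357 : ℝ) ≤ Real.log 0.8 ∧ Real.log 0.8 ≤ -0.22314354 := by
  apply log_bounds (x := 3 / 13) 1 8 <;> norm_num [Finset.sum_range_succ]

theorem log_tangent_crossover_bounds : (-0.42513071 : ℝ) ≤ Real.log 0.6536843444 ∧ Real.log 0.6536843444 ≤ -0.42513068 := by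
  apply log_bounds (x := 384210861 / 2884210861) 1 8 <;> norm_num [Finset.sum_range_succ]

theorem log_tangent_output_bounds : (-0.27764806 : ℝ) ≤ Real.log 0.7575634 ∧ Real.log 0.7575634 ≤ -0.27764803 := by
  apply log_bounds (x := 1287817 / 6287817) 1 8 <;> norm_num [Finset.sum_range_succ]

theorem log_tangent_compl_bounds : (-0.27995204 : ℝ) ≤ Real.log 0.75582 ∧ Real.log 0.75582 ≤ -0.27995201 := by
  apply log_bounds (x := 12791 / 62791) 1 8 <;> norm_num [Finset.sum_range_succ]

theorem log_tangent_bounds : (-1.40984964 : ℝ) ≤ Real.log 0.24418 ∧ Real.log 0.24418 ≤ -1.40984961 := by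
  apply log_bounds (x := 5959 / 18459) 3 8 <;> norm_num [Finset.sum_range_succ]

theorem log_metric_bounds : (0.30748468 : ℝ) ≤ Real.log 1.36 ∧ Real.log 1.36 ≤ 0.30748471 := by
  apply log_bounds (x := 9 / 59) 0 8 <;> norm_num [Finset.sum_range_succ]

theorem log_eight_twentyfifths_bounds : (-1.1396 : ℝ) ≤ Real.log 0.32 ∧ Real.log 0.32 ≤ -1.1393 := by
  apply log_bounds (x := 7 / 57) 2 5 <;> norm_num [Finset.sum_range_succ]

theorem log_midpoint_output_bounds : (-0.6256 : ℝ) ≤ Real.log 0.535 ∧ Real.log 0.535 ≤ -0.6253 := by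
  apply log_bounds (x := 7 / 207) 1 5 <;> norm_num [Finset.sum_range_succ]

theorem ConcaveOn.le_tangent {S : Set ℝ} {f : ℝ → ℝ} {m a x : ℝ} (hf : ConcaveOn ℝ S f)
    (ha : a ∈ S) (hx : x ∈ S) (hm : HasDerivAt f m a) : f x ≤ f a + m * (x - a) := by
  rcases lt_trichotomy x a with h | h | h
  · have := hf.le_slope_of_hasDerivAt hx ha h hm
    rw [slope_def_field, le_div_iff₀ (by linarith)] at this
    linarith
  · simp [h]
  · have := hf.slope_le_of_hasDerivAt ha hx h hm
    rw [slope_def_field, div_le_iff₀ (by linarith)] at this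
    linarith

/-- The mutual information of `zeroCellJoint p` as an explicit function of `p`. -/
noncomputable def zeroCellInfo (p : ℝ) : ℝ :=
  (0.42542 * Real.log 0.42542 + 0.57458 * Real.log 0.57458 + 0.22542 * Real.log 0.22542
      - 0.8 * Real.log 0.8) * p
    + (0.97 - 1.29542 * p) * Real.log (0.97 - 1.29542 * p)
    - (0.97 - 0.87 * p) * Real.log (0.97 - 0.87 * p)
    - (1 - p) * Real.log (1 - p) - 0.57458 * (p * Real.log p)

/-- The derivative of `zeroCellInfo`. -/
noncomputable def zeroCellInfoDeriv (p : ℝ) : ℝ :=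
  (0.42542 * Real.log 0.42542 + 0.57458 * Real.log 0.57458 + 0.22542 * Real.log 0.22542
      - 0.8 * Real.log 0.8)
    - 1.29542 * (Real.log (0.97 - 1.29542 * p) + 1)
    + 0.87 * (Real.log (0.97 - 0.87 * p) + 1)
    + (Real.log (1 - p) + 1) - 0.57458 * (Real.log p + 1)

theorem hasDerivAt_affine_mul_log {a b p : ℝ} (h : a - b * p ≠ 0) :
    HasDerivAt (fun p => (a - b * p) * Real.log (a - b * p))
      (-b * (Real.log (a - b * p) + 1)) p := by
  have h1 : HasDerivAt (fun p : ℝ => a - b * p) (-b) p := by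
    simpa using ((hasDerivAt_id p).const_mul b).const_sub a
  have h2 := (Real.hasDerivAt_mul_log h).comp p h1
  exact h2.congr_deriv (mul_comm _ _)

theorem hasDerivAt_log_affine {a b p : ℝ} (h : a - b * p ≠ 0) :
    HasDerivAt (fun p => Real.log (a - b * p)) (-b / (a - b * p)) p := by
  have h1 : HasDerivAt (fun p : ℝ => a - b * p) (-b) p := by
    simpa using ((hasDerivAt_id p).const_mul b).const_sub a
  exact h1.log h

theorem hasDerivAt_zeroCellInfo {p : ℝ} (h0 : 0 < p) (h1 : p ≤ 0.6) :
    HasDerivAt zeroCellInfo (zeroCellInfoDeriv p) p := by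
  have e1 := hasDerivAt_affine_mul_log (a := 0.97) (b := 1.29542) (p := p) (by norm_num; linarith)
  have e2 := hasDerivAt_affine_mul_log (a := 0.97) (b := 0.87) (p := p) (by norm_num; linarith)
  have e3 := hasDerivAt_affine_mul_log (a := 1) (b := 1) (p := p) (by norm_num; linarith)
  have e4 := (Real.hasDerivAt_mul_log h0.ne').const_mul 0.57458
  simp only [one_mul] at e3
  have e0 := (hasDerivAt_id p).const_mul (0.42542 * Real.log 0.42542 + 0.57458 * Real.log 0.57458
    + 0.22542 * Real.log 0.22542 - 0.8 * Real.log 0.8)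
  have e := (((e0.add e1).sub e2).sub e3).sub e4
  refine e.congr_deriv ?_
  unfold zeroCellInfoDeriv
  ring

theorem hasDerivAt_zeroCellInfoDeriv {p : ℝ} (h0 : 0 < p) (h1 : p ≤ 0.6) :
    HasDerivAt zeroCellInfoDeriv (1.29542 ^ 2 / (0.97 - 1.29542 * p)
      - 0.87 ^ 2 / (0.97 - 0.87 * p) - 1 / (1 - p) - 0.57458 / p) p := by
  have e1 := ((hasDerivAt_log_affine (a := 0.97) (b := 1.29542) (p := p)
    (by norm_num; linarith)).add_const 1).const_mul 1.29542
  have e2 := ((hasDerivAt_log_affine (a := 0.97) (b := 0.87) (p := p)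
    (by norm_num; linarith)).add_const 1).const_mul 0.87
  have e3 := (hasDerivAt_log_affine (a := 1) (b := 1) (p := p)
    (by norm_num; linarith)).add_const 1
  have e4 := ((Real.hasDerivAt_log h0.ne').add_const 1).const_mul 0.57458
  simp only [one_mul] at e3
  have e := (((e1.const_sub (0.42542 * Real.log 0.42542 + 0.57458 * Real.log 0.57458
    + 0.22542 * Real.log 0.22542 - 0.8 * Real.log 0.8)).add e2).add e3).sub e4
  refine e.congr_deriv ?_
  ring

theorem concaveOn_zeroCellInfo : ConcaveOn ℝ (Set.Icc 0 0.45) zeroCellInfo := by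
  have hcont : Continuous zeroCellInfo := by
    have h (a b : ℝ) : Continuous fun p : ℝ => (a - b * p) * Real.log (a - b * p) :=
      Real.continuous_mul_log.comp (by fun_prop)
    have h1 := h 1 1
    simp only [one_mul] at h1
    exact (((((continuous_const.mul continuous_id).add (h _ _)).sub (h _ _)).sub h1).sub
      (continuous_const.mul Real.continuous_mul_log))
  refine concaveOn_of_hasDerivWithinAt2_nonpos (convex_Icc _ _) hcont.continuousOn
    (f' := zeroCellInfoDeriv) (f'' := fun p => 1.29542 ^ 2 / (0.97 - 1.29542 * p)
      - 0.87 ^ 2 / (0.97 - 0.87 * p) - 1 / (1 - p) - 0.57458 / p) ?_ ?_ ?_ <;>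
    rw [interior_Icc] <;> rintro p ⟨h0, h1⟩
  · exact (hasDerivAt_zeroCellInfo h0 (by linarith)).hasDerivWithinAt
  · exact (hasDerivAt_zeroCellInfoDeriv h0 (by linarith)).hasDerivWithinAt
  · have ha : 0 < 0.97 - 1.29542 * p := by linarith
    have hb : 0 < 0.97 - 0.87 * p := by linarith
    have hc : 0 < 1 - p := by linarith
    have hb' : 1.2168 + 1.7 * (p - 0.4) ≤ 0.87 ^ 2 / (0.97 - 0.87 * p) := by
      rw [le_div_iff₀ hb]
      nlinarith [sq_nonneg (p - 0.4)]
    have hc' : 1.6666 + 2.777 * (p - 0.4) ≤ 1 / (1 - p) := by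
      rw [le_div_iff₀ hc]
      nlinarith [sq_nonneg (p - 0.4)]
    have ha' : 1.29542 ^ 2 / (0.97 - 1.29542 * p) ≤
        (1.2168 + 1.7 * (p - 0.4)) + (1.6666 + 2.777 * (p - 0.4)) + 0.57458 / p := by
      rw [← sub_le_iff_le_add', le_div_iff₀ h0, sub_mul, div_mul_eq_mul_div, sub_le_iff_le_add,
        div_le_iff₀ ha]
      nlinarith [mul_pos h0 h0, mul_nonneg h0.le (sq_nonneg (p - 0.4)),
        mul_pos (mul_pos h0 h0) (sub_pos.2 h1)]
    linarith

theorem zeroCellInfo_le_of_le {p : ℝ} (h0 : 0 ≤ p) (h1 : p ≤ 0.45) : zeroCellInfo p ≤ 0.1369 := by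
  have h := concaveOn_zeroCellInfo.le_tangent (a := 0.24418) (by norm_num) ⟨h0, h1⟩
    (hasDerivAt_zeroCellInfo (by norm_num) (by norm_num))
  obtain ⟨l1, u1⟩ := log_tau_compl_bounds
  obtain ⟨l2, u2⟩ := log_tau_bounds
  obtain ⟨l3, u3⟩ := log_alpha_bounds
  obtain ⟨l4, u4⟩ := log_four_fifths_bounds
  obtain ⟨l5, u5⟩ := log_tangent_crossover_bounds
  obtain ⟨l6, u6⟩ := log_tangent_output_bounds
  obtain ⟨l7, u7⟩ := log_tangent_compl_bounds
  obtain ⟨l8, u8⟩ := log_tangent_bounds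
  have e5 : (0.97 - 1.29542 * 0.24418 : ℝ) = 0.6536843444 := by norm_num
  have e6 : (0.97 - 0.87 * 0.24418 : ℝ) = 0.7575634 := by norm_num
  have e7 : (1 - 0.24418 : ℝ) = 0.75582 := by norm_num
  have hv : zeroCellInfo 0.24418 ≤ 0.136893 := by
    rw [zeroCellInfo, e5, e6, e7]
    linarith
  have hm : |zeroCellInfoDeriv 0.24418| ≤ 0.00001 := by
    rw [zeroCellInfoDeriv, e5, e6, e7, abs_le]
    constructor <;> linarith
  have := abs_le.1 hm
  nlinarith

theorem zeroCellInfo_le_of_ge {p : ℝ} (h0 : 0.45 ≤ p) (h1 : p ≤ 0.6) : zeroCellInfo p ≤ 0.1369 := by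
  have key {x x₀ : ℝ} (hx : 0 < x) (hx₀ : 0 < x₀) : x * Real.log x ≤ x * (Real.log x₀ + (x / x₀ - 1)) := by
    have := Real.log_le_sub_one_of_pos (div_pos hx hx₀)
    rw [Real.log_div hx.ne' hx₀.ne'] at this
    exact mul_le_mul_of_nonneg_left (by linarith) hx.le
  have key' {x x₀ : ℝ} (hx : 0 < x) (hx₀ : 0 < x₀) : x * Real.log x₀ + x - x₀ ≤ x * Real.log x := by
    have := Real.log_le_sub_one_of_pos (div_pos hx₀ hx)
    rw [Real.log_div hx₀.ne' hx.ne'] at this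
    have := mul_le_mul_of_nonneg_left this hx.le
    have e : x * (x₀ / x - 1) = x₀ - x := by field_simp
    linarith
  have ha := key (x := 0.97 - 1.29542 * p) (x₀ := 0.32) (by linarith) (by norm_num)
  have hb := key' (x := 0.97 - 0.87 * p) (x₀ := 0.535) (by linarith) (by norm_num)
  have hc := key' (x := 1 - p) (x₀ := 0.5) (by linarith) (by norm_num)
  have hd := key' (x := p) (x₀ := 0.5) (by linarith) (by norm_num)
  obtain ⟨l1, u1⟩ := log_tau_compl_bounds
  obtain ⟨l2, u2⟩ := log_tau_bounds
  obtain ⟨l3, u3⟩ := log_alpha_bounds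
  obtain ⟨l4, u4⟩ := log_four_fifths_bounds
  have e1 := mul_le_mul_of_nonneg_left log_eight_twentyfifths_bounds.2
    (show 0 ≤ 0.97 - 1.29542 * p by linarith)
  have e2 := mul_le_mul_of_nonneg_left log_midpoint_output_bounds.1
    (show 0 ≤ 0.97 - 0.87 * p by linarith)
  have e3 : (-0.6932 : ℝ) ≤ Real.log 0.5 := by
    have := Real.log_two_lt_d9
    rw [show (0.5 : ℝ) = 2⁻¹ by norm_num, Real.log_inv]
    linarith
  have e4 := mul_le_mul_of_nonneg_left e3 (show 0 ≤ 1 - p by linarith)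
  have e5 := mul_le_mul_of_nonneg_left e3 (show 0 ≤ p by linarith)
  have e6 : (0.42542 * Real.log 0.42542 + 0.57458 * Real.log 0.57458 + 0.22542 * Real.log 0.22542
      - 0.8 * Real.log 0.8) * p ≤ (-0.8392) * p :=
    mul_le_mul_of_nonneg_right (by linarith) (by linarith)
  have ha' : (0.97 - 1.29542 * p) * Real.log (0.97 - 1.29542 * p) ≤
      (0.97 - 1.29542 * p) * -1.1393 + (0.97 - 1.29542 * p) ^ 2 / 0.32 - (0.97 - 1.29542 * p) := by
    have e : (0.97 - 1.29542 * p) * (Real.log 0.32 + ((0.97 - 1.29542 * p) / 0.32 - 1)) =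
      (0.97 - 1.29542 * p) * Real.log 0.32 + (0.97 - 1.29542 * p) ^ 2 / 0.32
        - (0.97 - 1.29542 * p) := by ring
    linarith
  have hquad : (0.97 - 1.29542 * p) ^ 2 / 0.32 ≤ 0.46818 - 2.347 * (p - 0.45) := by
    rw [div_le_iff₀ (by norm_num)]
    nlinarith [mul_nonneg (sub_nonneg.2 h0) (sub_nonneg.2 h1)]
  unfold zeroCellInfo
  linarith

/-- A feasible joint weight with a vanishing cell, used for small `p = Q 1`. -/
noncomputable def zeroCellJoint (p : ℝ) : Fin 2 → Fin 3 → ℝ :=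
  ![![0.97 - 1.29542 * p, 0.03 + 0.07 * p, 0.22542 * p], ![0.42542 * p, 0, 0.57458 * p]]

theorem jointInfo_zeroCellJoint {p : ℝ} (h0 : 0 < p) (h1 : p ≤ 0.6) :
    jointInfo (zeroCellJoint p) = zeroCellInfo p := by
  have hlog (a b c : ℝ) (ha : 0 < a) (hb : 0 < b) (hc : 0 < c) :
      Real.log (a / (b * c)) = Real.log a - Real.log b - Real.log c := by
    rw [Real.log_div ha.ne' (by positivity), Real.log_mul hb.ne' hc.ne']
    ring
  have hmul (a : ℝ) (ha : 0 < a) : Real.log (a * p) = Real.log a + Real.log p :=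
    Real.log_mul ha.ne' h0.ne'
  have hX0 : 0.97 - 1.29542 * p + (0.03 + 0.07 * p) + 0.22542 * p = 1 - p := by ring
  have hX1 : 0.42542 * p + 0 + 0.57458 * p = p := by ring
  have hY0 : 0.97 - 1.29542 * p + 0.42542 * p = 0.97 - 0.87 * p := by ring
  have hY1 : 0.03 + 0.07 * p + 0 = 0.03 + 0.07 * p := by ring
  have hY2 : 0.22542 * p + 0.57458 * p = 0.8 * p := by ring
  simp only [jointInfo, zeroCellJoint, Fin.sum_univ_two, Fin.sum_univ_three, Matrix.cons_val_zero,
    Matrix.cons_val_one, Matrix.cons_val, hX0, hX1, hY0, hY1, hY2]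
  rw [hlog _ _ _ (by linarith) (by linarith) (by linarith),
    hlog _ _ _ (by linarith) (by linarith) (by linarith),
    hlog _ _ _ (by linarith) (by linarith) (by linarith),
    hlog (0.42542 * p) _ _ (by linarith) (by linarith) (by linarith),
    hlog (0.57458 * p) _ _ (by linarith) (by linarith) (by linarith),
    hmul _ (by norm_num), hmul _ (by norm_num), hmul _ (by norm_num), hmul _ (by norm_num)]
  unfold zeroCellInfo
  ring

theorem log_half_eq : Real.log 0.5 = -Real.log 2 := by
  rw [show (0.5 : ℝ) = 2⁻¹ by norm_num, Real.log_inv]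

theorem ILM_le_of_le {Q : Fin 2 → ℝ} (h0 : 0 ≤ Q 1) (h1 : Q 1 ≤ 0.6) (hQ : Q 0 = 1 - Q 1) :
    ILM Q ≤ 0.1369 := by
  refine ILM_le_of_feasible (by norm_num) (zeroCellJoint (Q 1)) ?_ ?_ ?_ ?_ ?_
  · intro x y
    fin_cases x <;> fin_cases y <;> simp [zeroCellJoint] <;> linarith
  · intro x
    fin_cases x <;> simp [zeroCellJoint, Fin.sum_univ_three, hQ] <;> ring
  · intro y
    fin_cases y <;> simp [zeroCellJoint, PY, W, Fin.sum_univ_two, hQ] <;> ring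
  · simp only [zeroCellJoint, W, q, Fin.sum_univ_two, Fin.sum_univ_three, Matrix.cons_val_zero,
      Matrix.cons_val_one, Matrix.cons_val, Real.log_one, log_half_eq]
    have h2 := Real.log_two_gt_d9
    have h3 := log_metric_bounds.2
    have := mul_nonneg h0 (show 0 ≤ 0.1 * Real.log 2 - 0.22542 * Real.log 1.36 by linarith)
    linarith
  · rcases h0.eq_or_lt with h | h
    · rw [← h]
      simp only [jointInfo, zeroCellJoint, Fin.sum_univ_two, Fin.sum_univ_three, Matrix.cons_val_zero,
        Matrix.cons_val_one, Matrix.cons_val]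
      norm_num
    · rw [jointInfo_zeroCellJoint h h1]
      rcases le_total (Q 1) 0.45 with h2 | h2
      · exact zeroCellInfo_le_of_le h.le h2
      · exact zeroCellInfo_le_of_ge h2 h1

/-- A feasible joint weight used for large `p = Q 1`. -/
noncomputable def chiSquareJoint (p : ℝ) : Fin 2 → Fin 3 → ℝ :=
  ![![0.52 * (1 - p), 0.17 * (1 - p), 0.31 * (1 - p)],
    ![0.1 * p + 0.45 * (1 - p), 0.1 * p - 0.14 * (1 - p), 0.8 * p - 0.31 * (1 - p)]]

theorem mul_log_div_le {a b : ℝ} (ha : 0 ≤ a) (hb : 0 < b) :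
    a * Real.log (a / b) ≤ a ^ 2 / b - a := by
  rcases ha.eq_or_lt with rfl | h
  · simp
  · have := mul_le_mul_of_nonneg_left (Real.log_le_sub_one_of_pos (div_pos h hb)) ha
    calc _ ≤ _ := this
      _ = _ := by ring

theorem chiSquare_column_le {r k w : ℝ} (hr : 0 < r) (hr' : 0 < 1 - r) (hk : 0 < k) (hw : 0 ≤ w)
    (hwk : w * r ≤ k) :
    w * r * Real.log (w * r / (r * k)) + (k - w * r) * Real.log ((k - w * r) / ((1 - r) * k)) ≤
      (w ^ 2 * r / k + k - 2 * w * r) / (1 - r) - k := by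
  have e : (w * r) ^ 2 / (r * k) + (k - w * r) ^ 2 / ((1 - r) * k) =
      (w ^ 2 * r / k + k - 2 * w * r) / (1 - r) := by
    field_simp
    ring
  linarith [mul_log_div_le (mul_nonneg hw hr.le) (mul_pos hr hk),
    mul_log_div_le (sub_nonneg.2 hwk) (mul_pos hr' hk)]

theorem chiSquare_sum_le {r : ℝ} (h0 : 0 < r) (h1 : r ≤ 0.4) :
    0.52 ^ 2 * r / (0.1 + 0.87 * r) + 0.17 ^ 2 * r / (0.1 - 0.07 * r)
      + 0.31 ^ 2 * r / (0.8 - 0.8 * r) ≤ r + 0.1369 * (1 - r) := by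
  have k0 : 0 < 0.1 + 0.87 * r := by linarith
  have k1 : 0 < 0.1 - 0.07 * r := by linarith
  have k2 : 0 < 0.8 - 0.8 * r := by linarith
  have b1 : 0.17 ^ 2 * r / (0.1 - 0.07 * r) ≤ (0.289 + 0.28098 * r) * r := by
    rw [mul_div_right_comm]
    refine mul_le_mul_of_nonneg_right ?_ h0.le
    rw [div_le_iff₀ k1]
    nlinarith
  have b2 : 0.31 ^ 2 * r / (0.8 - 0.8 * r) ≤ (0.120125 + 0.20021 * r) * r := by
    rw [mul_div_right_comm]
    refine mul_le_mul_of_nonneg_right ?_ h0.le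
    rw [div_le_iff₀ k2]
    nlinarith
  have b0 : 0.52 ^ 2 * r / (0.1 + 0.87 * r) ≤
      r + 0.1369 * (1 - r) - (0.409125 + 0.48119 * r) * r := by
    rw [div_le_iff₀ k0]
    nlinarith [mul_nonneg (sub_nonneg.2 h1) (sq_nonneg (r - 0.2142))]
  linarith

theorem chiSquareJoint_info_le {p : ℝ} (h0 : 0.6 ≤ p) (h1 : p < 1) :
    jointInfo (chiSquareJoint p) ≤ 0.1369 := by
  obtain ⟨r, rfl⟩ : ∃ r, p = 1 - r := ⟨1 - p, by ring⟩
  have hr0 : 0 < r := by linarith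
  have hr1 : r ≤ 0.4 := by linarith
  have hp : 0 < 1 - r := by linarith
  have hs := chiSquare_sum_le hr0 hr1
  have c0 := chiSquare_column_le (k := 0.1 + 0.87 * r) (w := 0.52) hr0 hp (by linarith)
    (by norm_num) (by linarith)
  have c1 := chiSquare_column_le (k := 0.1 - 0.07 * r) (w := 0.17) hr0 hp (by linarith)
    (by norm_num) (by linarith)
  have c2 := chiSquare_column_le (k := 0.8 - 0.8 * r) (w := 0.31) hr0 hp (by linarith)
    (by norm_num) (by linarith)
  have hX0 : 0.52 * r + 0.17 * r + 0.31 * r = r := by ring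
  have hP0 : 0.1 * (1 - r) + 0.45 * r = 0.1 + 0.87 * r - 0.52 * r := by ring
  have hP1 : 0.1 * (1 - r) - 0.14 * r = 0.1 - 0.07 * r - 0.17 * r := by ring
  have hP2 : 0.8 * (1 - r) - 0.31 * r = 0.8 - 0.8 * r - 0.31 * r := by ring
  have hX1 : 0.1 + 0.87 * r - 0.52 * r + (0.1 - 0.07 * r - 0.17 * r)
    + (0.8 - 0.8 * r - 0.31 * r) = 1 - r := by ring
  simp only [jointInfo, chiSquareJoint, Fin.sum_univ_two, Fin.sum_univ_three, Matrix.cons_val_zero,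
    Matrix.cons_val_one, Matrix.cons_val, sub_sub_cancel, hP0, hP1, hP2, hX0, hX1,
    add_sub_cancel]
  have hsum : (0.52 ^ 2 * r / (0.1 + 0.87 * r) + (0.1 + 0.87 * r) - 2 * 0.52 * r) / (1 - r)
      + (0.17 ^ 2 * r / (0.1 - 0.07 * r) + (0.1 - 0.07 * r) - 2 * 0.17 * r) / (1 - r)
      + (0.31 ^ 2 * r / (0.8 - 0.8 * r) + (0.8 - 0.8 * r) - 2 * 0.31 * r) / (1 - r) ≤ 1.1369 := by
    rw [← add_div, ← add_div, div_le_iff₀ hp]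
    linarith
  have hk : 0.1 + 0.87 * r + (0.1 - 0.07 * r) + (0.8 - 0.8 * r) = 1 := by ring
  linarith only [c0, c1, c2, hsum, hk]

theorem ILM_le_of_ge {Q : Fin 2 → ℝ} (h0 : 0.6 ≤ Q 1) (h1 : Q 1 ≤ 1) (hQ : Q 0 = 1 - Q 1) :
    ILM Q ≤ 0.1369 := by
  refine ILM_le_of_feasible (by norm_num) (chiSquareJoint (Q 1)) ?_ ?_ ?_ ?_ ?_
  · intro x y
    fin_cases x <;> fin_cases y <;> simp [chiSquareJoint] <;> linarith
  · intro x
    fin_cases x <;> simp [chiSquareJoint, Fin.sum_univ_three, hQ] <;> ring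
  · intro y
    fin_cases y <;> simp [chiSquareJoint, PY, W, Fin.sum_univ_two, hQ] <;> ring
  · simp only [chiSquareJoint, W, q, Fin.sum_univ_two, Fin.sum_univ_three, Matrix.cons_val_zero,
      Matrix.cons_val_one, Matrix.cons_val, Real.log_one, log_half_eq]
    have h2 := Real.log_two_gt_d9
    have h3 := log_metric_bounds.2
    have := mul_nonneg (sub_nonneg.2 h1)
      (show 0 ≤ 0.14 * Real.log 2 - 0.31 * Real.log 1.36 by linarith)
    linarith
  · rcases h1.eq_or_lt with h | h
    · rw [h]
      simp only [jointInfo, chiSquareJoint, Fin.sum_univ_two, Fin.sum_univ_three, Matrix.cons_val_zero,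
        Matrix.cons_val_one, Matrix.cons_val]
      norm_num
    · exact chiSquareJoint_info_le h0 h

theorem ILM_le {Q : Fin 2 → ℝ} (h0 : ∀ x, 0 ≤ Q x) (h1 : ∑ x, Q x = 1) : ILM Q ≤ 0.1369 := by
  rw [Fin.sum_univ_two] at h1
  rcases le_total (Q 1) 0.6 with h | h
  · exact ILM_le_of_le (h0 1) h (by linarith)
  · exact ILM_le_of_ge h (by linarith [h0 0]) (by linarith)

section RandomCoding

variable {ι α : Type*} [Fintype ι] [DecidableEq ι] [Fintype α]

theorem sum_prod_apply (g : ι → α → ℝ) : ∑ c : ι → α, ∏ i, g i (c i) = ∏ i, ∑ a, g i a := by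
  rw [Finset.prod_univ_sum, Fintype.piFinset_univ]

theorem sum_prod_mul_coord {w : α → ℝ} (hw : ∑ a, w a = 1) (f : α → ℝ) (i : ι) :
    ∑ c : ι → α, (∏ k, w (c k)) * f (c i) = ∑ a, w a * f a := by
  have h (c : ι → α) : (∏ k, w (c k)) * f (c i) =
      ∏ k, w (c k) * (if k = i then f (c k) else 1) := by
    rw [Finset.prod_mul_distrib, Finset.prod_ite_eq' Finset.univ i (fun k => f (c k))]
    simp
  simp_rw [h]
  rw [sum_prod_apply (fun k a => w a * if k = i then f a else 1),
    Finset.prod_eq_single i (fun k _ hk => by simp [hk, hw]) (by simp)]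
  simp

theorem sum_prod_mul_coord_pair {w : α → ℝ} (hw : ∑ a, w a = 1) (f : α → α → ℝ) {i j : ι}
    (hij : i ≠ j) :
    ∑ c : ι → α, (∏ k, w (c k)) * f (c i) (c j) = ∑ a, ∑ b, w a * w b * f a b := by
  classical
  have h (c : ι → α) : (∏ k, w (c k)) * f (c i) (c j) =
      ∑ b, f (c i) b * ∏ k, w (c k) * (if k = j then (if c k = b then 1 else 0) else 1) := by
    simp_rw [Finset.prod_mul_distrib, Finset.prod_ite_eq' Finset.univ j
      (fun k => if c k = _ then (1 : ℝ) else 0)]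
    simp [mul_comm]
  have h' (b : α) (c : ι → α) :
      f (c i) b * ∏ k, w (c k) * (if k = j then (if c k = b then 1 else 0) else 1) =
      ∏ k, w (c k) * (if k = j then (if c k = b then 1 else 0) else 1)
        * (if k = i then f (c k) b else 1) := by
    conv_rhs => rw [Finset.prod_mul_distrib, Finset.prod_ite_eq' Finset.univ i (fun k => f (c k) b)]
    simp [mul_comm]
  simp_rw [h]
  rw [Finset.sum_comm]
  simp_rw [h']
  rw [Finset.sum_comm (s := Finset.univ (α := α)) (t := Finset.univ (α := α))]
  refine Finset.sum_congr rfl fun b _ => ?_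
  rw [sum_prod_apply (fun k a => w a * (if k = j then (if a = b then 1 else 0) else 1)
        * (if k = i then f a b else 1)),
    Finset.prod_eq_mul i j hij (fun k _ hk => by simp [hk.1, hk.2, hw]) (by simp) (by simp)]
  simp [hij, hij.symm, Finset.sum_mul]
  exact Finset.sum_congr rfl fun a _ => by ring

theorem sum_prod_mul_pairs {w : α → ℝ} (hw : ∑ a, w a = 1) (f : α → ℝ) (g : α → α → ℝ) :
    ∑ c : ι → α, (∏ k, w (c k)) *
      (∑ i, f (c i) + ∑ i, ∑ j, if j = i then 0 else g (c i) (c j)) =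
      Fintype.card ι * ∑ a, w a * f a +
        Fintype.card ι * (Fintype.card ι - 1) * ∑ a, ∑ b, w a * w b * g a b := by
  simp_rw [mul_add, Finset.sum_add_distrib, Finset.mul_sum (s := Finset.univ (α := ι))]
  rw [Finset.sum_comm]
  simp_rw [sum_prod_mul_coord hw]
  congr 1
  · simp
  rw [Finset.sum_comm]
  have h (i : ι) : ∑ c : ι → α, ∑ j, ((∏ k, w (c k)) * if j = i then 0 else g (c i) (c j)) =
      (Fintype.card ι - 1) * ∑ a, ∑ b, w a * w b * g a b := by
    rw [Finset.sum_comm]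
    have h' (j : ι) : ∑ c : ι → α, ((∏ k, w (c k)) * if j = i then 0 else g (c i) (c j)) =
        if j = i then 0 else ∑ a, ∑ b, w a * w b * g a b := by
      split_ifs with hj
      · simp
      · exact sum_prod_mul_coord_pair hw g (Ne.symm hj)
    simp_rw [h']
    rw [Finset.sum_ite, Finset.sum_const_zero, zero_add, Finset.sum_const, nsmul_eq_mul,
      Finset.filter_ne', Finset.card_erase_of_mem (Finset.mem_univ i), Finset.card_univ,
      Nat.cast_sub (Fintype.card_pos_iff.2 ⟨i⟩), Nat.cast_one]
  simp_rw [h]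
  rw [Finset.sum_const, nsmul_eq_mul, Finset.card_univ, mul_assoc]

theorem exists_le_of_sum_mul_le {w f : α → ℝ} {b : ℝ} (h0 : ∀ a, 0 ≤ w a) (hw : ∑ a, w a = 1)
    (h : ∑ a, w a * f a ≤ b) : ∃ a, f a ≤ b := by
  by_contra! hf
  have h1 : ∑ a, w a * (f a - b) ≤ 0 := by
    simp_rw [mul_sub, Finset.sum_sub_distrib, ← Finset.sum_mul, hw]
    linarith
  have h2 (a : α) (_ : a ∈ Finset.univ) : 0 ≤ w a * (f a - b) :=
    mul_nonneg (h0 a) (sub_nonneg.2 (hf a).le)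
  have h3 := (Finset.sum_eq_zero_iff_of_nonneg h2).1 (le_antisymm h1 (Finset.sum_nonneg h2))
  have h4 : ∑ a, w a = 0 := Finset.sum_eq_zero fun a ha =>
    (mul_eq_zero.1 (h3 a ha)).resolve_right (sub_pos.2 (hf a)).ne'
  linarith

end RandomCoding

/-- The weak law of large numbers for a finite alphabet. -/
theorem exists_forall_sum_prod_mul_deviation_le {Ω : Type*} [Fintype Ω] {p : Ω → ℝ}
    (hp0 : ∀ ω, 0 ≤ p ω) (hp : ∑ ω, p ω = 1) (f : Ω → ℝ) {δ ε : ℝ} (hδ : 0 < δ) (hε : 0 < ε) :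
    ∃ N : ℕ, ∀ n : ℕ, N ≤ n → ∑ ω : Fin n → Ω, (∏ i, p (ω i)) *
      (if |∑ i, f (ω i) - n * ∑ ω, p ω * f ω| ≤ n * δ then 0 else 1) ≤ ε := by
  set m := ∑ ω, p ω * f ω with hm
  set v := ∑ ω, p ω * (f ω - m) ^ 2
  have hv : 0 ≤ v := Finset.sum_nonneg fun ω _ => mul_nonneg (hp0 ω) (sq_nonneg _)
  obtain ⟨N, hN⟩ := exists_nat_gt (v / (δ ^ 2 * ε))
  refine ⟨N + 1, fun n hn => ?_⟩
  have hn0 : (0 : ℝ) < n := by exact_mod_cast (by omega : 0 < n)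
  have hmean : ∑ ω, p ω * (f ω - m) = 0 := by
    simp_rw [mul_sub, Finset.sum_sub_distrib, ← Finset.sum_mul, hp]
    linarith
  have hvar := sum_prod_mul_pairs (ι := Fin n) hp (fun ω => (f ω - m) ^ 2)
    (fun a b => (f a - m) * (f b - m))
  have hcov : ∑ a, ∑ b, p a * p b * ((f a - m) * (f b - m)) = 0 := by
    have (a b : Ω) : p a * p b * ((f a - m) * (f b - m)) =
      (p a * (f a - m)) * (p b * (f b - m)) := by ring
    simp_rw [this, ← Finset.mul_sum, hmean]
    simp
  rw [hcov, mul_zero, add_zero, Fintype.card_fin] at hvar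
  have hle (ω : Fin n → Ω) : (∏ i, p (ω i)) *
      (if |∑ i, f (ω i) - n * m| ≤ n * δ then 0 else 1) ≤ ((n * δ) ^ 2)⁻¹ * ((∏ i, p (ω i)) *
      (∑ i, (f (ω i) - m) ^ 2 + ∑ i, ∑ j, if j = i then 0 else (f (ω i) - m) * (f (ω j) - m))) := by
    have hsq : ∑ i, (f (ω i) - m) ^ 2 + ∑ i, ∑ j, (if j = i then 0 else
        (f (ω i) - m) * (f (ω j) - m)) = (∑ i, f (ω i) - n * m) ^ 2 := by
      rw [← Finset.sum_add_distrib]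
      have (i : Fin n) : (f (ω i) - m) ^ 2 + ∑ j, (if j = i then 0 else
          (f (ω i) - m) * (f (ω j) - m)) = ∑ j, (f (ω i) - m) * (f (ω j) - m) := by
        rw [← Finset.add_sum_erase _ _ (Finset.mem_univ i), if_pos rfl, zero_add,
          ← Finset.add_sum_erase _ (fun j => (f (ω i) - m) * (f (ω j) - m)) (Finset.mem_univ i),
          sq]
        congr 1
        exact Finset.sum_congr rfl fun j hj => if_neg (Finset.ne_of_mem_erase hj)
      simp_rw [this, ← Finset.mul_sum, ← Finset.sum_mul, ← sq, Finset.sum_sub_distrib]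
      simp
    rw [hsq, mul_left_comm]
    refine mul_le_mul_of_nonneg_left ?_ (Finset.prod_nonneg fun i _ => hp0 _)
    split_ifs with h
    · positivity
    · rw [← div_eq_inv_mul, one_le_div (by positivity)]
      exact sq_le_sq' (by linarith [mul_pos hn0 hδ, abs_nonneg (∑ i, f (ω i) - n * m)]) (not_le.1 h).le |>.trans (sq_abs _).le
  refine (Finset.sum_le_sum fun ω _ => hle ω).trans ?_
  rw [← Finset.mul_sum, hvar, ← div_eq_inv_mul, div_le_iff₀ (by positivity)]
  have h1 : v < δ ^ 2 * ε * n := by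
    rw [div_lt_iff₀' (by positivity)] at hN
    refine hN.trans_le (mul_le_mul_of_nonneg_left ?_ (by positivity))
    exact_mod_cast (by omega : N ≤ n)
  calc (n : ℝ) * v ≤ n * (δ ^ 2 * ε * n) := by gcongr
    _ = _ := by ring

section Superposition

variable {ι ι' A B Y : Type*} [Fintype ι] [DecidableEq ι] [Fintype ι'] [DecidableEq ι'] [Fintype A]
  [Fintype B] [Fintype Y]

open Classical in
theorem indicator_exists_ne_le (D : ι → ι' → Prop) (k : ι) (l : ι') :
    (if ∃ m : ι × ι', m ≠ (k, l) ∧ D m.1 m.2 then (1 : ℝ) else 0) ≤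
      (∑ l', if l' = l then 0 else if D k l' then 1 else 0) +
        ∑ k', if k' = k then 0 else min 1 (∑ l', if D k' l' then 1 else 0) := by
  have h1 (l' : ι') : (0 : ℝ) ≤ if l' = l then 0 else if D k l' then 1 else 0 := by
    split_ifs <;> norm_num
  have h2 (k' : ι) : (0 : ℝ) ≤ ∑ l', if D k' l' then 1 else 0 :=
    Finset.sum_nonneg fun l' _ => by split_ifs <;> norm_num
  have h3 (k' : ι) : (0 : ℝ) ≤ if k' = k then 0 else min 1 (∑ l', if D k' l' then 1 else 0) := by
    split_ifs
    · rfl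
    · exact le_min zero_le_one (h2 k')
  split_ifs with h
  · obtain ⟨⟨k', l'⟩, hne, hD⟩ := h
    by_cases hk : k' = k
    · subst hk
      have hl : l' ≠ l := fun h => hne (by rw [h])
      have := Finset.single_le_sum (f := fun l' => (if l' = l then (0 : ℝ) else
        if D k' l' then 1 else 0)) (fun l' _ => h1 l') (Finset.mem_univ l')
      simp only [if_neg hl, if_pos hD] at this
      linarith [Finset.sum_nonneg fun k' (_ : k' ∈ Finset.univ) => h3 k']
    · have := Finset.single_le_sum (f := fun k' => (if k' = k then (0 : ℝ) else
        min 1 (∑ l', if D k' l' then 1 else 0))) (fun k' _ => h3 k') (Finset.mem_univ k')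
      have h5 : (1 : ℝ) ≤ ∑ l', if D k' l' then 1 else 0 := by
        have := Finset.single_le_sum (f := fun l' => (if D k' l' then (1 : ℝ) else 0))
          (fun l' _ => by split_ifs <;> norm_num) (Finset.mem_univ l')
        simpa only [if_pos hD] using this
      simp only [if_neg hk, min_eq_left h5] at this
      linarith [Finset.sum_nonneg fun l' (_ : l' ∈ Finset.univ) => h1 l']
  · exact add_nonneg (Finset.sum_nonneg fun l' _ => h1 l') (Finset.sum_nonneg fun k' _ => h3 k')

open Classical in
/-- Random superposition coding: cloud centres are drawn from `μ`, satellites from `κ`. -/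
theorem exists_superposition_code {μ : A → ℝ} {κ : A → B → ℝ} {w : B → Y → ℝ}
    {G : B → Y → Prop} {beats : B → B → Y → Prop} {η₀ η₁ η₂ : ℝ}
    (hμ0 : ∀ u, 0 ≤ μ u) (hμ : ∑ u, μ u = 1) (hκ0 : ∀ u b, 0 ≤ κ u b) (hκ : ∀ u, ∑ b, κ u b = 1)
    (hw0 : ∀ b y, 0 ≤ w b y) (hw : ∀ b, ∑ y, w b y = 1) (hη₁ : 0 ≤ η₁) (hη₂ : 0 ≤ η₂)
    (h0 : ∑ u, μ u * ∑ b, κ u b * ∑ y, (if G b y then 0 else w b y) ≤ η₀)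
    (h1 : ∀ u b y, 0 < κ u b → G b y → ∑ b', κ u b' * (if beats b' b y then 1 else 0) ≤ η₁)
    (h2 : ∀ b y, G b y → ∑ u, μ u * min 1 (Fintype.card ι' *
      ∑ b', κ u b' * (if beats b' b y then 1 else 0)) ≤ η₂) :
    ∃ c : ι → ι' → B, ∑ k, ∑ l, ∑ y, w (c k l) y *
        (if ∃ m : ι × ι', m ≠ (k, l) ∧ beats (c m.1 m.2) (c k l) y then 1 else 0) ≤
      Fintype.card ι * Fintype.card ι' * (η₀ + Fintype.card ι' * η₁ + Fintype.card ι * η₂) := by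
  set K : ℝ := (Fintype.card ι : ℝ)
  set L : ℝ := (Fintype.card ι' : ℝ)
  have hK : 0 ≤ K := Nat.cast_nonneg _
  have hL : 0 ≤ L := Nat.cast_nonneg _
  set β : B → B → Y → ℝ := fun b' b y => if beats b' b y then 1 else 0 with hβ
  have hβ0 (b' b y) : 0 ≤ β b' b y := by
    simp only [hβ]
    split_ifs <;> norm_num
  set g : B → Y → ℝ := fun b y => if G b y then w b y else 0 with hg
  have hg0 (b y) : 0 ≤ g b y := by
    simp only [hg]
    split_ifs
    · exact hw0 b y
    · rfl
  have hgw (b) : ∑ y, g b y ≤ 1 := by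
    rw [← hw b]
    refine Finset.sum_le_sum fun y _ => ?_
    simp only [hg]
    split_ifs
    · rfl
    · exact hw0 b y
  set e₁ : B → ℝ := fun b => ∑ y, (if G b y then 0 else w b y) with he₁
  set e₂ : B → B → ℝ := fun b b' => ∑ y, g b y * β b' b y with he₂
  set e₃ : B → (ι' → B) → ℝ := fun b v => ∑ y, g b y * min 1 (∑ l, β (v l) b y) with he₃
  set ν : A × (ι' → B) → ℝ := fun C => μ C.1 * ∏ l, κ C.1 (C.2 l) with hν
  have hprod (u : A) : ∑ v : ι' → B, ∏ l, κ u (v l) = 1 := by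
    rw [sum_prod_apply fun (_ : ι') b => κ u b]
    simp [hκ]
  have hν0 (C) : 0 ≤ ν C := mul_nonneg (hμ0 _) (Finset.prod_nonneg fun l _ => hκ0 _ _)
  have hν1 : ∑ C, ν C = 1 := by
    rw [Fintype.sum_prod_type]
    simp only [hν, ← Finset.mul_sum, hprod, mul_one, hμ]
  set E₁ : A × (ι' → B) → ℝ := fun C =>
    ∑ l, e₁ (C.2 l) + ∑ l, ∑ l', if l' = l then 0 else e₂ (C.2 l) (C.2 l') with hE₁
  set E₂ : A × (ι' → B) → A × (ι' → B) → ℝ := fun C C' => ∑ l, e₃ (C.2 l) C'.2 with hE₂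
  have he2 (u b) (hb : 0 < κ u b) : ∑ b', κ u b' * e₂ b b' ≤ η₁ := by
    have e : ∑ b', κ u b' * e₂ b b' = ∑ y, g b y * ∑ b', κ u b' * β b' b y := by
      simp only [he₂, Finset.mul_sum]
      rw [Finset.sum_comm]
      exact Finset.sum_congr rfl fun y _ => Finset.sum_congr rfl fun b' _ => by ring
    rw [e]
    calc _ ≤ ∑ y, g b y * η₁ := by
          refine Finset.sum_le_sum fun y _ => ?_
          by_cases h : G b y
          · exact mul_le_mul_of_nonneg_left (h1 u b y hb h) (hg0 b y)
          · simp [hg, h]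
      _ ≤ 1 * η₁ := by
          rw [← Finset.sum_mul]
          exact mul_le_mul_of_nonneg_right (hgw b) hη₁
      _ = η₁ := one_mul _
  have he3 (b) : ∑ C, ν C * e₃ b C.2 ≤ η₂ := by
    have hin (u y) : ∑ v : ι' → B, (∏ l, κ u (v l)) * min 1 (∑ l, β (v l) b y) ≤
        min 1 (L * ∑ b', κ u b' * β b' b y) := by
      have hp (v : ι' → B) : 0 ≤ ∏ l, κ u (v l) := Finset.prod_nonneg fun l _ => hκ0 _ _
      refine le_min ?_ ?_
      · exact (Finset.sum_le_sum fun v _ =>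
          mul_le_of_le_one_right (hp v) (min_le_left _ _)).trans_eq (hprod u)
      · refine (Finset.sum_le_sum fun v _ =>
          mul_le_mul_of_nonneg_left (min_le_right _ _) (hp v)).trans ?_
        simp_rw [Finset.mul_sum]
        rw [Finset.sum_comm]
        simp_rw [sum_prod_mul_coord (hκ u) fun b' => β b' b y]
        simp [L, Finset.mul_sum]
    have e : ∑ C, ν C * e₃ b C.2 = ∑ y, g b y * ∑ u, μ u *
        ∑ v : ι' → B, (∏ l, κ u (v l)) * min 1 (∑ l, β (v l) b y) := by
      calc _ = ∑ C : A × (ι' → B), ∑ y, g b y * (μ C.1 * ((∏ l, κ C.1 (C.2 l)) *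
            min 1 (∑ l, β (C.2 l) b y))) := by
            refine Finset.sum_congr rfl fun C _ => ?_
            rw [he₃, Finset.mul_sum]
            exact Finset.sum_congr rfl fun y _ => by ring
        _ = _ := by
            rw [Finset.sum_comm]
            simp_rw [Fintype.sum_prod_type, Finset.mul_sum]
    rw [e]
    calc _ ≤ ∑ y, g b y * η₂ := by
          refine Finset.sum_le_sum fun y _ => ?_
          by_cases h : G b y
          · refine mul_le_mul_of_nonneg_left ((Finset.sum_le_sum fun u _ =>
              mul_le_mul_of_nonneg_left (hin u y) (hμ0 u)).trans (h2 b y h)) (hg0 b y)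
          · simp [hg, h]
      _ ≤ 1 * η₂ := by
          rw [← Finset.sum_mul]
          exact mul_le_mul_of_nonneg_right (hgw b) hη₂
      _ = η₂ := one_mul _
  have hexp1 : ∑ C, ν C * E₁ C ≤ L * (η₀ + L * η₁) := by
    have e : ∑ C, ν C * E₁ C = ∑ u, μ u * (L * ∑ b, κ u b * e₁ b +
        L * (L - 1) * ∑ b, ∑ b', κ u b * κ u b' * e₂ b b') := by
      rw [Fintype.sum_prod_type]
      refine Finset.sum_congr rfl fun u _ => ?_
      rw [← sum_prod_mul_pairs (hκ u), Finset.mul_sum]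
      exact Finset.sum_congr rfl fun v _ => mul_assoc _ _ _
    have h3 (u) : 0 ≤ ∑ b, ∑ b', κ u b * κ u b' * e₂ b b' := by
      refine Finset.sum_nonneg fun b _ => Finset.sum_nonneg fun b' _ =>
        mul_nonneg (mul_nonneg (hκ0 _ _) (hκ0 _ _)) (Finset.sum_nonneg fun y _ =>
          mul_nonneg (hg0 _ _) (hβ0 _ _ _))
    have h4 (u) : ∑ b, ∑ b', κ u b * κ u b' * e₂ b b' ≤ η₁ := by
      calc _ ≤ ∑ b, κ u b * η₁ := by
            refine Finset.sum_le_sum fun b _ => ?_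
            simp_rw [mul_assoc, ← Finset.mul_sum]
            rcases (hκ0 u b).eq_or_lt with h | h
            · simp [← h]
            · exact mul_le_mul_of_nonneg_left (he2 u b h) h.le
        _ = η₁ := by rw [← Finset.sum_mul, hκ, one_mul]
    rw [e]
    calc _ ≤ ∑ u, (L * (μ u * ∑ b, κ u b * e₁ b) + μ u * (L * L * η₁)) := by
          refine Finset.sum_le_sum fun u _ => ?_
          have : L * (L - 1) * ∑ b, ∑ b', κ u b * κ u b' * e₂ b b' ≤ L * L * η₁ := by
            have := mul_le_mul_of_nonneg_left (h4 u) (mul_nonneg hL hL)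
            nlinarith [mul_nonneg hL (h3 u)]
          have := mul_le_mul_of_nonneg_left this (hμ0 u)
          linarith
      _ = L * (∑ u, μ u * ∑ b, κ u b * e₁ b) + L * L * η₁ := by
          rw [Finset.sum_add_distrib, ← Finset.mul_sum, ← Finset.sum_mul, hμ, one_mul]
      _ ≤ L * η₀ + L * L * η₁ := by gcongr
      _ = _ := by ring
  have hexp2 : ∑ C, ∑ C', ν C * ν C' * E₂ C C' ≤ L * η₂ := by
    calc _ = ∑ C, ν C * ∑ l, ∑ C', ν C' * e₃ (C.2 l) C'.2 := by
          refine Finset.sum_congr rfl fun C _ => ?_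
          rw [Finset.sum_comm (s := Finset.univ (α := ι')), Finset.mul_sum]
          refine Finset.sum_congr rfl fun C' _ => ?_
          rw [← Finset.mul_sum, mul_assoc]
      _ ≤ ∑ C, ν C * ∑ l : ι', η₂ := by
          gcongr with C _ l _
          · exact hν0 C
          · exact he3 _
      _ = L * η₂ := by
          rw [← Finset.sum_mul, hν1]
          simp [L]
  have hexp := sum_prod_mul_pairs (ι := ι) hν1 E₁ E₂
  obtain ⟨c, hc⟩ := exists_le_of_sum_mul_le (w := fun c : ι → A × (ι' → B) => ∏ k, ν (c k))
    (fun c => Finset.prod_nonneg fun k _ => hν0 _)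
    (by rw [sum_prod_apply fun (_ : ι) C => ν C]; simp [hν1]) hexp.le
  refine ⟨fun k => (c k).2, ?_⟩
  have hE2 : 0 ≤ ∑ C, ∑ C', ν C * ν C' * E₂ C C' := by
    refine Finset.sum_nonneg fun C _ => Finset.sum_nonneg fun C' _ =>
      mul_nonneg (mul_nonneg (hν0 _) (hν0 _)) (Finset.sum_nonneg fun l _ => Finset.sum_nonneg
        fun y _ => mul_nonneg (hg0 _ _) (le_min zero_le_one (Finset.sum_nonneg fun _ _ => hβ0 _ _ _)))
  calc _ ≤ ∑ k, E₁ (c k) + ∑ k, ∑ k', (if k' = k then 0 else E₂ (c k) (c k')) := by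
        rw [← Finset.sum_add_distrib]
        refine Finset.sum_le_sum fun k _ => ?_
        have hterm (l : ι') (y : Y) : w ((c k).2 l) y * (if ∃ m : ι × ι', m ≠ (k, l) ∧
            beats ((c m.1).2 m.2) ((c k).2 l) y then 1 else 0) ≤
            (if G ((c k).2 l) y then 0 else w ((c k).2 l) y) + g ((c k).2 l) y *
              ((∑ l', if l' = l then 0 else β ((c k).2 l') ((c k).2 l) y) +
                ∑ k', if k' = k then 0 else min 1 (∑ l', β ((c k').2 l') ((c k).2 l) y)) := by
          simp only [hg]
          by_cases hG : G ((c k).2 l) y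
          · rw [if_pos hG, if_pos hG, zero_add]
            exact mul_le_mul_of_nonneg_left (indicator_exists_ne_le
              (fun k' l' => beats ((c k').2 l') ((c k).2 l) y) k l) (hw0 _ _)
          · rw [if_neg hG, if_neg hG, zero_mul, add_zero]
            exact mul_le_of_le_one_right (hw0 _ _) (by split_ifs <;> norm_num)
        refine (Finset.sum_le_sum fun l _ => Finset.sum_le_sum fun y _ => hterm l y).trans_eq ?_
        simp only [hE₁, hE₂, he₁, he₂, he₃, mul_add, Finset.sum_add_distrib, Finset.mul_sum,
          mul_ite, mul_zero, add_assoc]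
        congr 2
        · refine Finset.sum_congr rfl fun l _ => ?_
          rw [Finset.sum_comm]
          refine Finset.sum_congr rfl fun l' _ => ?_
          split_ifs <;> simp
        · simp_rw [Finset.sum_comm (s := Finset.univ (α := Y))]
          rw [Finset.sum_comm]
          refine Finset.sum_congr rfl fun k' _ => ?_
          split_ifs <;> simp
    _ ≤ _ := hc
    _ ≤ K * (L * (η₀ + L * η₁)) + K * K * (L * η₂) := by
        gcongr
        · linarith
    _ = _ := by ring

end Superposition

open Classical in
theorem sum_subtype_eq_sum_ite {α : Type*} [Fintype α] (p : α → Prop) (f : α → ℝ) :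
    ∑ a : {a // p a}, f a = ∑ a, if p a then f a else 0 := by
  rw [← Finset.sum_filter]
  exact (Finset.sum_subtype _ (by simp) f).symm

open Classical in
/-- Random superposition coding with satellites restricted to a likely set `T`. -/
theorem exists_superposition_code_of_restrict {ι ι' A B Y : Type*} [Fintype ι] [DecidableEq ι]
    [Fintype ι'] [DecidableEq ι'] [Fintype A] [Fintype B] [Fintype Y] {P : B → ℝ} {PU : A → ℝ}
    {π : B → A} {T : B → Prop} {w : B → Y → ℝ} {G : B → Y → Prop} {beats : B → B → Y → Prop}
    {η₀ η₁ η₂ : ℝ} (hP0 : ∀ b, 0 ≤ P b) (hP : ∑ b, P b = 1)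
    (hPU : ∀ u, PU u = ∑ b, if π b = u then P b else 0)
    (hT : ∑ b, (if T b then 0 else P b) ≤ 1 / 4)
    (hw0 : ∀ b y, 0 ≤ w b y) (hw : ∀ b, ∑ y, w b y = 1) (hη₁ : 0 ≤ η₁) (hη₂ : 0 ≤ η₂)
    (h0 : ∑ b, P b * ∑ y, (if G b y then 0 else w b y) ≤ η₀)
    (h1 : ∀ b y, T b → G b y →
      ∑ b', (if π b' = π b ∧ T b' ∧ beats b' b y then P b' else 0) ≤ η₁ * PU (π b))
    (h2 : ∀ b y, T b → G b y → ∑ u, PU u * min 1 (2 * Fintype.card ι' *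
      (∑ b', if π b' = u ∧ T b' ∧ beats b' b y then P b' else 0) / PU u) ≤ η₂) :
    ∃ c : ι → ι' → B, ∑ k, ∑ l, ∑ y, w (c k l) y *
        (if ∃ m : ι × ι', m ≠ (k, l) ∧ beats (c m.1 m.2) (c k l) y then 1 else 0) ≤
      Fintype.card ι * Fintype.card ι' *
        (4 * η₀ + Fintype.card ι' * (2 * η₁) + Fintype.card ι * (2 * η₂)) := by
  set PT : A → ℝ := fun u => ∑ b : {b // T b}, if π b = u then P b else 0 with hPT
  have hPT' (u) : PT u = ∑ b, if T b then (if π b = u then P b else 0) else 0 :=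
    sum_subtype_eq_sum_ite T fun b => if π b = u then P b else 0
  have hPU0 (u) : 0 ≤ PU u := by
    rw [hPU]
    exact Finset.sum_nonneg fun b _ => by split_ifs; exacts [hP0 b, le_rfl]
  have hPT0 (u) : 0 ≤ PT u := by
    rw [hPT]
    exact Finset.sum_nonneg fun b _ => by split_ifs; exacts [hP0 b, le_rfl]
  have hPTU (u) : PT u ≤ PU u := by
    rw [hPT', hPU]
    refine Finset.sum_le_sum fun b _ => ?_
    split_ifs
    exacts [le_rfl, le_rfl, hP0 b, le_rfl]
  have hPU1 : ∑ u, PU u = 1 := by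
    simp_rw [hPU]
    rw [Finset.sum_comm, ← hP]
    simp
  have hPT1 : 1 - 1 / 4 ≤ ∑ u, PT u := by
    have e : ∑ u, PT u = ∑ b, if T b then P b else 0 := by
      simp_rw [hPT']
      rw [Finset.sum_comm]
      refine Finset.sum_congr rfl fun b _ => ?_
      split_ifs <;> simp
    have e2 : ∑ b, (if T b then P b else 0) + ∑ b, (if T b then 0 else P b) = 1 := by
      rw [← Finset.sum_add_distrib, ← hP]
      refine Finset.sum_congr rfl fun b _ => ?_
      split_ifs <;> simp
    linarith
  obtain ⟨good, hgood⟩ : ∃ good : A → Prop, ∀ u, good u ↔ 0 < PT u ∧ PU u ≤ 2 * PT u :=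
    ⟨_, fun u => Iff.rfl⟩
  have hg1 (u : {u // good u}) : 0 < PT u := ((hgood u).1 u.2).1
  have hg2 (u : {u // good u}) : PU u ≤ 2 * PT u := ((hgood u).1 u.2).2
  set Z : ℝ := ∑ u : {u // good u}, PU u with hZ
  have hZ2 : 1 / 2 ≤ Z := by
    have e : 1 - Z ≤ ∑ u, 2 * (PU u - PT u) := by
      rw [hZ, sum_subtype_eq_sum_ite good PU, ← hPU1, ← Finset.sum_sub_distrib]
      refine Finset.sum_le_sum fun u _ => ?_
      have := hPT0 u
      have := hPTU u
      split_ifs with h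
      · linarith
      · rw [hgood u, not_and_or, not_lt, not_le] at h
        rcases h with h | h
        · linarith [hPU0 u]
        · linarith
    rw [← Finset.mul_sum, Finset.sum_sub_distrib, hPU1] at e
    linarith
  have hZ0 : 0 < Z := by linarith
  have hμle (u) : PU u / Z ≤ 2 * PU u := by
    rw [div_le_iff₀ hZ0]
    nlinarith [hPU0 u]
  have hκle (u : {u // good u}) {S : ℝ} (hS : 0 ≤ S) : S / PT u ≤ 2 * S / PU u := by
    have h3 : 0 < PU u := (hg1 u).trans_le (hPTU u)
    rw [div_le_div_iff₀ (hg1 u) h3]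
    nlinarith [hg2 u]
  have hS0 (u b y) : 0 ≤ ∑ b', if π b' = u ∧ T b' ∧ beats b' b y then P b' else 0 :=
    Finset.sum_nonneg fun b' _ => by split_ifs; exacts [hP0 b', le_rfl]
  have hκβ (u : {u // good u}) (b : B) (y : Y) :
      ∑ b' : {b // T b}, (if π b' = u then P b' else 0) / PT u * (if beats b' b y then 1 else 0) =
      (∑ b', if π b' = u ∧ T b' ∧ beats b' b y then P b' else 0) / PT u := by
    rw [sum_subtype_eq_sum_ite T fun b' => (if π b' = u then P b' else 0) / PT u *
      (if beats b' b y then 1 else 0), Finset.sum_div]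
    refine Finset.sum_congr rfl fun b' _ => ?_
    by_cases ha : π b' = u <;> by_cases hb : T b' <;> by_cases hc : beats b' b y <;>
      simp [ha, hb, hc]
  have h0' : ∑ u : {u // good u}, PU u / Z * ∑ b : {b // T b}, (if π b = u then P b else 0) / PT u *
      ∑ y, (if G b y then 0 else w b y) ≤ 4 * η₀ := by
    have hE0 (b) : 0 ≤ ∑ y, (if G b y then 0 else w b y) :=
      Finset.sum_nonneg fun y _ => by split_ifs; exacts [le_rfl, hw0 b y]
    have hF0 (u b) : 0 ≤ (if π b = u then P b else 0) * ∑ y, (if G b y then 0 else w b y) :=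
      mul_nonneg (by split_ifs; exacts [hP0 b, le_rfl]) (hE0 b)
    calc _ ≤ ∑ u : {u // good u}, ∑ b : {b // T b},
          4 * ((if π b = u then P b else 0) * ∑ y, (if G b y then 0 else w b y)) := by
          refine Finset.sum_le_sum fun u _ => ?_
          rw [Finset.mul_sum]
          refine Finset.sum_le_sum fun b _ => ?_
          have h3 : PU u / Z / PT u ≤ 4 := by
            rw [div_le_iff₀ (hg1 u)]
            linarith [hμle u, hg2 u]
          have := mul_le_mul_of_nonneg_right h3 (hF0 u b)
          calc _ = _ := by ring
            _ ≤ _ := this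
      _ ≤ ∑ u, ∑ b, 4 * ((if π b = u then P b else 0) * ∑ y, (if G b y then 0 else w b y)) := by
          rw [sum_subtype_eq_sum_ite good fun u => ∑ b : {b // T b},
            4 * ((if π b = u then P b else 0) * ∑ y, (if G b y then 0 else w b y))]
          refine Finset.sum_le_sum fun u _ => ?_
          rw [sum_subtype_eq_sum_ite T fun b =>
            4 * ((if π b = u then P b else 0) * ∑ y, (if G b y then 0 else w b y))]
          have h4 (b) : 0 ≤ 4 * ((if π b = u then P b else 0) * ∑ y, (if G b y then 0 else w b y)) :=
            mul_nonneg (by norm_num) (hF0 u b)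
          split_ifs
          · refine Finset.sum_le_sum fun b _ => ?_
            by_cases h5 : T b
            · exact (if_pos h5).le
            · exact (if_neg h5).trans_le (h4 b)
          · exact Finset.sum_nonneg fun b _ => h4 b
      _ = 4 * ∑ b, P b * ∑ y, (if G b y then 0 else w b y) := by
          rw [Finset.sum_comm, Finset.mul_sum]
          refine Finset.sum_congr rfl fun b _ => ?_
          rw [← Finset.mul_sum, ← Finset.sum_mul]
          simp
      _ ≤ _ := by gcongr
  have h1' (u : {u // good u}) (b : {b // T b}) (y : Y)
      (hb : 0 < (if π b = u then P b else 0) / PT u) (hG : G b y) :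
      ∑ b' : {b // T b}, (if π b' = u then P b' else 0) / PT u * (if beats b' b y then 1 else 0) ≤
        2 * η₁ := by
    have hu : π b = u := by
      by_contra h
      simp [h] at hb
    rw [hκβ u b y, div_le_iff₀ (hg1 u)]
    have h3 := h1 b y b.2 hG
    rw [hu] at h3
    nlinarith [hg2 u]
  have h2' (b : {b // T b}) (y : Y) (hG : G b y) :
      ∑ u : {u // good u}, PU u / Z * min 1 (Fintype.card ι' *
        ∑ b' : {b // T b}, (if π b' = u then P b' else 0) / PT u *
          (if beats b' b y then 1 else 0)) ≤ 2 * η₂ := by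
    refine le_trans ?_ (mul_le_mul_of_nonneg_left (h2 b y b.2 hG) zero_le_two)
    rw [Finset.mul_sum]
    simp_rw [hκβ]
    rw [sum_subtype_eq_sum_ite good fun u => PU u / Z * min 1 (Fintype.card ι' *
      ((∑ b', if π b' = u ∧ T b' ∧ beats b' b y then P b' else 0) / PT u))]
    refine Finset.sum_le_sum fun u _ => ?_
    split_ifs with hu
    · rw [← mul_assoc]
      refine mul_le_mul (hμle u) (min_le_min le_rfl ?_) (le_min zero_le_one ?_)
        (mul_nonneg zero_le_two (hPU0 u))
      · calc _ ≤ Fintype.card ι' * (2 * (∑ b', if π b' = u ∧ T b' ∧ beats b' b y then P b' else 0)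
              / PU u) := mul_le_mul_of_nonneg_left (hκle ⟨u, hu⟩ (hS0 u b y)) (Nat.cast_nonneg _)
          _ = _ := by ring
      · exact mul_nonneg (Nat.cast_nonneg _) (div_nonneg (hS0 u b y) (hPT0 u))
    · exact mul_nonneg zero_le_two (mul_nonneg (hPU0 u) (le_min zero_le_one
        (div_nonneg (mul_nonneg (by positivity) (hS0 u b y)) (hPU0 u))))
  obtain ⟨c, hc⟩ := exists_superposition_code (ι := ι) (ι' := ι')
    (μ := fun u : {u // good u} => PU u / Z)
    (κ := fun u (b : {b // T b}) => (if π b = u then P b else 0) / PT u)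
    (w := fun b y => w b y) (G := fun b y => G b y) (beats := fun b' b y => beats b' b y)
    (η₀ := 4 * η₀) (η₁ := 2 * η₁) (η₂ := 2 * η₂)
    (fun u => div_nonneg (hPU0 u) hZ0.le)
    (by rw [← Finset.sum_div, div_self hZ0.ne'])
    (fun u b => div_nonneg (by split_ifs; exacts [hP0 b, le_rfl]) (hPT0 u))
    (fun u => by rw [← Finset.sum_div, div_self (hg1 u).ne'])
    (fun b y => hw0 b y) (fun b => hw b) (by positivity) (by positivity) h0' h1' h2'
  exact ⟨fun k l => c k l, hc⟩

section Achievability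

variable {V U Y : Type*} {n : ℕ}

theorem sum_sum_eq_sum_pair [Fintype V] [Fintype Y] {ι : Type*} [Fintype ι] [DecidableEq ι]
    (f : (ι → V) → (ι → Y) → ℝ) :
    ∑ b, ∑ y, f b y = ∑ ω : ι → V × Y, f (fun i => (ω i).1) (fun i => (ω i).2) := by
  rw [← Fintype.sum_prod_type']
  exact (Fintype.sum_equiv (Equiv.arrowProdEquivProdArrow ι (fun _ => V) (fun _ => Y)) _ _
    fun ω => rfl).symm

theorem sum_ite_comp_eq_prod_sum [Fintype V] [DecidableEq U] {ι : Type*} [Fintype ι] [DecidableEq ι]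
    (um : V → U) (h : ι → V → ℝ) (u : ι → U) [DecidablePred fun b : ι → V => um ∘ b = u] :
    ∑ b : ι → V, (if um ∘ b = u then ∏ i, h i (b i) else 0) =
      ∏ i, ∑ v, if um v = u i then h i v else 0 := by
  rw [← sum_prod_apply fun i v => if um v = u i then h i v else 0]
  refine Finset.sum_congr rfl fun b _ => ?_
  split_ifs with hb
  · refine Finset.prod_congr rfl fun i _ => ?_
    exact (if_pos (congrFun hb i)).symm
  · obtain ⟨i, hi⟩ := Function.ne_iff.1 hb
    exact (Finset.prod_eq_zero (Finset.mem_univ i) (if_neg hi)).symm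

theorem prod_eq_exp_sum_log {ι : Type*} [Fintype ι] {f : ι → ℝ} (hf : ∀ i, 0 < f i) :
    ∏ i, f i = Real.exp (∑ i, Real.log (f i)) := by
  rw [Real.exp_sum]
  exact Finset.prod_congr rfl fun i _ => (Real.exp_log (hf i)).symm

/-- A tilted weight of a competing word is large if both words have typical cost `a`. -/
theorem tilted_weight_le {A : V → ℝ} {g : V → Y → ℝ} (hA : ∀ v, 0 < A v) (hg : ∀ v y, 0 < g v y)
    (s : ℕ) {a δ : ℝ} {b b' : Fin n → V} {y : Fin n → Y}
    (hb : |∑ i, Real.log (A (b i)) - n * a| ≤ n * δ)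
    (hb' : |∑ i, Real.log (A (b' i)) - n * a| ≤ n * δ)
    (h : ∏ i, g (b i) (y i) ≤ ∏ i, g (b' i) (y i)) :
    ∏ i, A (b i) * g (b i) (y i) ^ s ≤
      Real.exp (2 * (n * δ)) * ∏ i, A (b' i) * g (b' i) (y i) ^ s := by
  have h1 : ∏ i, A (b i) ≤ Real.exp (2 * (n * δ)) * ∏ i, A (b' i) := by
    rw [prod_eq_exp_sum_log fun i => hA (b i), prod_eq_exp_sum_log fun i => hA (b' i),
      ← Real.exp_add, Real.exp_le_exp]
    rw [abs_le] at hb hb'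
    linarith
  rw [Finset.prod_mul_distrib, Finset.prod_mul_distrib, Finset.prod_pow, Finset.prod_pow,
    ← mul_assoc]
  refine mul_le_mul h1 (pow_le_pow_left₀ (Finset.prod_nonneg fun i _ => (hg _ _).le) h s)
    (pow_nonneg (Finset.prod_nonneg fun i _ => (hg _ _).le) s)
    (mul_nonneg (Real.exp_pos _).le (Finset.prod_nonneg fun i _ => (hA _).le))

/-- The probability that a word with cloud centre `u` beats a typical word. -/
theorem sum_beats_le [Fintype V] [DecidableEq U] {Q A : V → ℝ} {g : V → Y → ℝ} {um : V → U} {S : U → Y → ℝ}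
    (hQ : ∀ v, 0 < Q v) (hA : ∀ v, 0 < A v) (hg : ∀ v y, 0 < g v y) (s : ℕ)
    (hS : ∀ u y, S u y = ∑ v, if um v = u then Q v * (A v * g v y ^ s) else 0)
    {a δ : ℝ} {b : Fin n → V} {y : Fin n → Y} (u : Fin n → U)
    {_ : DecidablePred fun b' : Fin n → V => um ∘ b' = u ∧
      |∑ i, Real.log (A (b' i)) - n * a| ≤ n * δ ∧ ∏ i, g (b i) (y i) ≤ ∏ i, g (b' i) (y i)}
    (hb : |∑ i, Real.log (A (b i)) - n * a| ≤ n * δ) :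
    ∑ b' : Fin n → V, (if um ∘ b' = u ∧ |∑ i, Real.log (A (b' i)) - n * a| ≤ n * δ ∧
        ∏ i, g (b i) (y i) ≤ ∏ i, g (b' i) (y i) then ∏ i, Q (b' i) else 0) ≤
      Real.exp (2 * (n * δ)) / (∏ i, A (b i) * g (b i) (y i) ^ s) * ∏ i, S (u i) (y i) := by
  have hΘ (b : Fin n → V) : 0 < ∏ i, A (b i) * g (b i) (y i) ^ s :=
    Finset.prod_pos fun i _ => mul_pos (hA _) (pow_pos (hg _ _) s)
  have hP (b : Fin n → V) : 0 < ∏ i, Q (b i) := Finset.prod_pos fun i _ => hQ _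
  simp_rw [hS]
  rw [← sum_ite_comp_eq_prod_sum um fun i v => Q v * (A v * g v (y i) ^ s), Finset.mul_sum]
  refine Finset.sum_le_sum fun b' _ => ?_
  rw [Finset.prod_mul_distrib (f := fun i => Q (b' i))]
  have h3 : 0 ≤ Real.exp (2 * (n * δ)) / (∏ i, A (b i) * g (b i) (y i) ^ s) *
      ((∏ i, Q (b' i)) * ∏ i, A (b' i) * g (b' i) (y i) ^ s) :=
    (mul_pos (div_pos (Real.exp_pos _) (hΘ b)) (mul_pos (hP b') (hΘ b'))).le
  by_cases hu : um ∘ b' = u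
  · rw [if_pos hu]
    split_ifs with h
    · rw [div_mul_eq_mul_div, le_div_iff₀ (hΘ b)]
      have := mul_le_mul_of_nonneg_left (tilted_weight_le hA hg s hb h.2.1 h.2.2) (hP b').le
      linarith
    · exact h3
  · rw [if_neg hu, if_neg fun h => hu h.1, mul_zero]

theorem mul_min_one_div_le {p r : ℝ} (hp : 0 ≤ p) (hr : 0 ≤ r) :
    p * min 1 (r / p) ≤ √(r * p) := by
  rcases hp.eq_or_lt with rfl | hp
  · simp
  have h : min 1 (r / p) ≤ √(r / p) := by
    rcases le_total 1 (r / p) with h | h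
    · rw [min_eq_left h]
      exact Real.one_le_sqrt.2 h
    · rw [min_eq_right h]
      exact Real.le_sqrt_of_sq_le (by nlinarith [div_nonneg hr hp.le])
  calc _ ≤ p * √(r / p) := mul_le_mul_of_nonneg_left h hp.le
    _ = √(r * p) := by
      rw [← Real.sqrt_sq hp.le, ← Real.sqrt_mul (sq_nonneg p), Real.sqrt_sq hp.le]
      congr 1
      field_simp

open Classical in
/-- Superposition codes of a fixed length, with cloud-centre map `um` and tilting `A`. -/
theorem exists_superposition_code_iid [Fintype V] [Fintype U] [Fintype Y] {ι ι' : Type*} [Fintype ι] [DecidableEq ι]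
    [Fintype ι'] [DecidableEq ι'] {Q A : V → ℝ} {w g : V → Y → ℝ} {um : V → U} {QU : U → ℝ}
    {S : U → Y → ℝ} {D : Y → ℝ} (s : ℕ) {a δ F₀ F₁ η₀ : ℝ} (hQ : ∀ v, 0 < Q v)
    (hQ1 : ∑ v, Q v = 1) (hA : ∀ v, 0 < A v) (hg : ∀ v y, 0 < g v y)
    (hw0 : ∀ v y, 0 ≤ w v y) (hw : ∀ v, ∑ y, w v y = 1)
    (hQU : ∀ u, QU u = ∑ v, if um v = u then Q v else 0)
    (hS : ∀ u y, S u y = ∑ v, if um v = u then Q v * (A v * g v y ^ s) else 0)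
    (hD0 : ∀ y, 0 < D y) (hD : ∀ y, ∑ u, √(QU u * S u y) ≤ D y)
    (hT : ∑ b : Fin n → V, (if |∑ i, Real.log (A (b i)) - n * a| ≤ n * δ then 0 else ∏ i, Q (b i))
      ≤ 1 / 4)
    (h0 : ∑ b : Fin n → V, (∏ i, Q (b i)) * ∑ y : Fin n → Y,
      (if n * (F₀ - δ) ≤ ∑ i, Real.log (√(A (b i) * g (b i) (y i) ^ s) / D (y i)) ∧
        n * (F₁ - δ) ≤ ∑ i, Real.log (A (b i) * g (b i) (y i) ^ s * QU (um (b i)) /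
          S (um (b i)) (y i)) then 0 else ∏ i, w (b i) (y i)) ≤ η₀) :
    ∃ c : ι → ι' → Fin n → V, ∑ k, ∑ l, ∑ y : Fin n → Y, (∏ i, w (c k l i) (y i)) *
        (if ∃ m : ι × ι', m ≠ (k, l) ∧
          ∏ i, g (c k l i) (y i) ≤ ∏ i, g (c m.1 m.2 i) (y i) then 1 else 0) ≤
      Fintype.card ι * Fintype.card ι' *
        (4 * η₀ + Fintype.card ι' * (2 * Real.exp (n * (3 * δ - F₁))) +
          Fintype.card ι * (2 * (√(2 * Fintype.card ι') * Real.exp (n * (2 * δ - F₀))))) := by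
  have hθ (v y) : 0 < A v * g v y ^ s := mul_pos (hA v) (pow_pos (hg v y) s)
  have hQU0 (v) : 0 < QU (um v) := by
    rw [hQU]
    refine Finset.sum_pos' (fun v' _ => ?_) ⟨v, Finset.mem_univ v, by simpa using hQ v⟩
    split_ifs
    exacts [(hQ v').le, le_rfl]
  have hS0 (v y) : 0 < S (um v) y := by
    rw [hS]
    refine Finset.sum_pos' (fun v' _ => ?_)
      ⟨v, Finset.mem_univ v, by simpa using mul_pos (hQ v) (hθ v y)⟩
    split_ifs
    exacts [(mul_pos (hQ v') (hθ v' y)).le, le_rfl]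
  have hQU0' (u) : 0 ≤ QU u := by
    rw [hQU]
    exact Finset.sum_nonneg fun v _ => by split_ifs; exacts [(hQ v).le, le_rfl]
  have hS0' (u y) : 0 ≤ S u y := by
    rw [hS]
    exact Finset.sum_nonneg fun v _ => by
      split_ifs; exacts [(mul_pos (hQ v) (hθ v y)).le, le_rfl]
  refine exists_superposition_code_of_restrict (ι := ι) (ι' := ι')
    (P := fun b : Fin n → V => ∏ i, Q (b i)) (PU := fun u : Fin n → U => ∏ i, QU (u i))
    (π := fun b => um ∘ b) (T := fun b => |∑ i, Real.log (A (b i)) - n * a| ≤ n * δ)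
    (w := fun b (y : Fin n → Y) => ∏ i, w (b i) (y i))
    (G := fun b y => n * (F₀ - δ) ≤ ∑ i, Real.log (√(A (b i) * g (b i) (y i) ^ s) / D (y i)) ∧
        n * (F₁ - δ) ≤ ∑ i, Real.log (A (b i) * g (b i) (y i) ^ s * QU (um (b i)) /
          S (um (b i)) (y i)))
    (beats := fun b' b y => ∏ i, g (b i) (y i) ≤ ∏ i, g (b' i) (y i))
    (fun b => Finset.prod_nonneg fun i _ => (hQ _).le) ?_ ?_ hT
    (fun b y => Finset.prod_nonneg fun i _ => hw0 _ _) ?_ (Real.exp_pos _).le (by positivity)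
    (by convert h0) ?_ ?_
  · rw [sum_prod_apply fun (_ : Fin n) v => Q v]
    simp [hQ1]
  · intro u
    simp_rw [hQU]
    convert (sum_ite_comp_eq_prod_sum um (fun _ v => Q v) u).symm
  · intro b
    rw [sum_prod_apply fun i y => w (b i) y]
    simp [hw]
  · intro b y hb hG
    refine (sum_beats_le hQ hA hg s hS (um ∘ b) hb).trans ?_
    have hΘ : 0 < ∏ i, A (b i) * g (b i) (y i) ^ s := Finset.prod_pos fun i _ => hθ _ _
    have hS1 : 0 < ∏ i, S (um (b i)) (y i) := Finset.prod_pos fun i _ => hS0 _ _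
    have h := Real.exp_le_exp.2 hG.2
    rw [← prod_eq_exp_sum_log fun i => div_pos (mul_pos (hθ _ _) (hQU0 _)) (hS0 _ _),
      Finset.prod_div_distrib, le_div_iff₀ hS1, Finset.prod_mul_distrib] at h
    have e : Real.exp (n * (3 * δ - F₁)) * Real.exp (n * (F₁ - δ)) = Real.exp (2 * (n * δ)) := by
      rw [← Real.exp_add]
      ring_nf
    rw [div_mul_eq_mul_div, div_le_iff₀ hΘ, ← e]
    have := mul_le_mul_of_nonneg_left h (Real.exp_pos (n * (3 * δ - F₁))).le
    simp only [Function.comp_apply]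
    linarith
  · intro b y hb hG
    have hΘ : 0 < ∏ i, A (b i) * g (b i) (y i) ^ s := Finset.prod_pos fun i _ => hθ _ _
    set Θ := ∏ i, A (b i) * g (b i) (y i) ^ s with hΘd
    calc _ ≤ ∑ u : Fin n → U, √(2 * Fintype.card ι') * Real.exp (n * δ) / √Θ *
          ∏ i, √(QU (u i) * S (u i) (y i)) := Finset.sum_le_sum fun u _ => ?_
      _ ≤ _ := ?_
    · have hPU : 0 ≤ ∏ i, QU (u i) := Finset.prod_nonneg fun i _ => hQU0' _
      refine (mul_min_one_div_le hPU (mul_nonneg (by positivity)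
        (Finset.sum_nonneg fun b' _ => by
          split_ifs
          exacts [Finset.prod_nonneg fun i _ => (hQ _).le, le_rfl]))).trans ?_
      have hsqrt : ∏ i, √(QU (u i) * S (u i) (y i)) =
          √((∏ i, QU (u i)) * ∏ i, S (u i) (y i)) := by
        rw [← Finset.prod_mul_distrib,
          Real.sqrt_prod _ fun i _ => mul_nonneg (hQU0' _) (hS0' _ _)]
      have hexp : Real.exp (n * δ) = √(Real.exp (2 * (n * δ))) := by
        rw [two_mul, Real.exp_add, Real.sqrt_mul_self (Real.exp_pos _).le]
      rw [hsqrt, hexp, ← Real.sqrt_mul (by positivity), ← Real.sqrt_div (by positivity),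
        ← Real.sqrt_mul (by positivity)]
      refine Real.sqrt_le_sqrt ?_
      calc _ ≤ 2 * (Fintype.card ι' : ℝ) * (Real.exp (2 * (n * δ)) / Θ * ∏ i, S (u i) (y i)) *
            ∏ i, QU (u i) :=
            mul_le_mul_of_nonneg_right (mul_le_mul_of_nonneg_left
              (sum_beats_le hQ hA hg s hS u hb) (by positivity)) hPU
        _ = _ := by ring
    · rw [← Finset.mul_sum, sum_prod_apply fun i u => √(QU u * S u (y i))]
      have hDle : ∏ i, ∑ u, √(QU u * S u (y i)) ≤ ∏ i, D (y i) :=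
        Finset.prod_le_prod (fun i _ => Finset.sum_nonneg fun u _ => Real.sqrt_nonneg _)
          fun i _ => hD _
      have h := Real.exp_le_exp.2 hG.1
      rw [← prod_eq_exp_sum_log fun i => div_pos (Real.sqrt_pos.2 (hθ _ _)) (hD0 _),
        Finset.prod_div_distrib, le_div_iff₀ (Finset.prod_pos fun i _ => hD0 _),
        ← Real.sqrt_prod _ fun i _ => (hθ _ _).le] at h
      have e : Real.exp (n * δ) = Real.exp (n * (2 * δ - F₀)) * Real.exp (n * (F₀ - δ)) := by
        rw [← Real.exp_add]
        ring_nf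
      rw [div_mul_eq_mul_div, div_le_iff₀ (Real.sqrt_pos.2 hΘ)]
      calc _ ≤ √(2 * Fintype.card ι') * Real.exp (n * δ) * ∏ i, D (y i) := by gcongr
        _ = √(2 * Fintype.card ι') * Real.exp (n * (2 * δ - F₀)) *
            (Real.exp (n * (F₀ - δ)) * ∏ i, D (y i)) := by rw [e]; ring
        _ ≤ _ := by gcongr

end Achievability

open Classical in
/-- If two functions of a random pair concentrate, then both are typically almost at least
their means. -/
theorem exists_forall_sum_not_typical_le {V Y : Type*} [Fintype V] [Fintype Y] {Q : V → ℝ}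
    {w : V → Y → ℝ} (hQ : ∀ v, 0 < Q v) (hQ1 : ∑ v, Q v = 1)
    (hw0 : ∀ v y, 0 ≤ w v y) (hw : ∀ v, ∑ y, w v y = 1) (f₀ f₁ : V → Y → ℝ) {δ η : ℝ}
    (hδ : 0 < δ) (hη : 0 < η) :
    ∃ N : ℕ, ∀ n : ℕ, N ≤ n → ∑ b : Fin n → V, (∏ i, Q (b i)) * ∑ y : Fin n → Y,
      (if n * (∑ v, ∑ y, Q v * w v y * f₀ v y - δ) ≤ ∑ i, f₀ (b i) (y i) ∧
        n * (∑ v, ∑ y, Q v * w v y * f₁ v y - δ) ≤ ∑ i, f₁ (b i) (y i) then 0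
        else ∏ i, w (b i) (y i)) ≤ η := by
  have hp0 (ω : V × Y) : 0 ≤ Q ω.1 * w ω.1 ω.2 := mul_nonneg (hQ _).le (hw0 _ _)
  have hp : ∑ ω : V × Y, Q ω.1 * w ω.1 ω.2 = 1 := by
    rw [Fintype.sum_prod_type]
    simp_rw [← Finset.mul_sum, hw, mul_one, hQ1]
  have hm (f : V → Y → ℝ) : ∑ ω : V × Y, Q ω.1 * w ω.1 ω.2 * f ω.1 ω.2 =
      ∑ v, ∑ y, Q v * w v y * f v y := Fintype.sum_prod_type _
  obtain ⟨N₀, h₀⟩ := exists_forall_sum_prod_mul_deviation_le hp0 hp (fun ω => f₀ ω.1 ω.2) hδ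
    (half_pos hη)
  obtain ⟨N₁, h₁⟩ := exists_forall_sum_prod_mul_deviation_le hp0 hp (fun ω => f₁ ω.1 ω.2) hδ
    (half_pos hη)
  rw [hm] at h₀ h₁
  generalize ∑ v, ∑ y, Q v * w v y * f₀ v y = m₀ at h₀ ⊢
  generalize ∑ v, ∑ y, Q v * w v y * f₁ v y = m₁ at h₁ ⊢
  refine ⟨max N₀ N₁, fun n hn => ?_⟩
  have h := add_le_add (h₀ n ((le_max_left _ _).trans hn)) (h₁ n ((le_max_right _ _).trans hn))
  rw [add_halves, ← Finset.sum_add_distrib] at h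
  refine le_trans ?_ h
  simp_rw [Finset.mul_sum]
  rw [sum_sum_eq_sum_pair]
  refine Finset.sum_le_sum fun ω _ => ?_
  have hP : 0 ≤ ∏ i, Q (ω i).1 * w (ω i).1 (ω i).2 := Finset.prod_nonneg fun i _ => hp0 _
  rw [mul_ite, mul_zero, ← Finset.prod_mul_distrib, ← mul_add]
  split_ifs with h1 h2 h3 h3 h2 h3 h3
  all_goals first
    | nlinarith
    | skip
  rw [abs_le] at h2 h3
  exact absurd ⟨by linarith, by linarith⟩ h1

theorem exp_le_ceil_exp (x : ℝ) : Real.exp x ≤ ⌈Real.exp x⌉₊ := Nat.le_ceil _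

theorem ceil_exp_le {x : ℝ} (hx : 0 ≤ x) : (⌈Real.exp x⌉₊ : ℝ) ≤ 2 * Real.exp x := by
  have := Nat.ceil_lt_add_one (Real.exp_pos x).le
  have := Real.one_le_exp hx
  linarith

/-- Achievability of the superposition-coding rates for mismatched decoding. -/
theorem exists_superposition_code_of_rates {V U Y : Type*} [Fintype V] [Fintype U] [Fintype Y]
    [DecidableEq U] {Q A : V → ℝ} {w g : V → Y → ℝ} {um : V → U} {QU : U → ℝ}
    {S : U → Y → ℝ} {D : Y → ℝ} (s : ℕ) {R₀ R₁ : ℝ} (hQ : ∀ v, 0 < Q v)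
    (hQ1 : ∑ v, Q v = 1) (hA : ∀ v, 0 < A v) (hg : ∀ v y, 0 < g v y)
    (hw0 : ∀ v y, 0 ≤ w v y) (hw : ∀ v, ∑ y, w v y = 1)
    (hQU : ∀ u, QU u = ∑ v, if um v = u then Q v else 0)
    (hS : ∀ u y, S u y = ∑ v, if um v = u then Q v * (A v * g v y ^ s) else 0)
    (hD0 : ∀ y, 0 < D y) (hD : ∀ y, ∑ u, √(QU u * S u y) ≤ D y)
    (hR₀ : 0 ≤ R₀) (hR₁ : 0 ≤ R₁)
    (hF₀ : R₀ + R₁ / 2 < ∑ v, ∑ y, Q v * w v y * Real.log (√(A v * g v y ^ s) / D y))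
    (hF₁ : R₁ < ∑ v, ∑ y, Q v * w v y * Real.log (A v * g v y ^ s * QU (um v) / S (um v) y))
    {ε : ℝ} (hε : 0 < ε) :
    ∃ N : ℕ, ∀ n : ℕ, N ≤ n → ∃ K L : ℕ, Real.exp (n * R₀) ≤ K ∧ Real.exp (n * R₁) ≤ L ∧
      ∃ c : Fin K → Fin L → Fin n → V, ∑ k, ∑ l, ∑ y : Fin n → Y, (∏ i, w (c k l i) (y i)) *
        (if ∃ m : Fin K × Fin L, m ≠ (k, l) ∧
          ∏ i, g (c k l i) (y i) ≤ ∏ i, g (c m.1 m.2 i) (y i) then 1 else 0) ≤ K * L * ε := by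
  classical
  set F₀ := ∑ v, ∑ y, Q v * w v y * Real.log (√(A v * g v y ^ s) / D y) with hF₀d
  set F₁ := ∑ v, ∑ y, Q v * w v y * Real.log (A v * g v y ^ s * QU (um v) / S (um v) y) with hF₁d
  obtain ⟨δ, hδ, hδ₀, hδ₁⟩ : ∃ δ : ℝ, 0 < δ ∧ 3 * δ ≤ F₀ - (R₀ + R₁ / 2) ∧ 4 * δ ≤ F₁ - R₁ := by
    refine ⟨min (F₀ - (R₀ + R₁ / 2)) (F₁ - R₁) / 4, ?_, ?_, ?_⟩
    · have := lt_min (sub_pos.2 hF₀) (sub_pos.2 hF₁)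
      linarith
    · have := min_le_left (F₀ - (R₀ + R₁ / 2)) (F₁ - R₁)
      linarith
    · have := min_le_right (F₀ - (R₀ + R₁ / 2)) (F₁ - R₁)
      linarith
  obtain ⟨N₁, h₁⟩ := exists_forall_sum_prod_mul_deviation_le (fun v => (hQ v).le) hQ1
    (fun v => Real.log (A v)) hδ (show (0 : ℝ) < 1 / 4 by norm_num)
  obtain ⟨N₂, h₂⟩ := exists_forall_sum_not_typical_le hQ hQ1 hw0 hw
    (fun v y => Real.log (√(A v * g v y ^ s) / D y))
    (fun v y => Real.log (A v * g v y ^ s * QU (um v) / S (um v) y)) hδ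
    (show 0 < ε / 8 by positivity)
  have hlim : Filter.Tendsto (fun n : ℕ => 12 * Real.exp (-(n * δ))) Filter.atTop (nhds 0) := by
    have := (Real.tendsto_exp_neg_atTop_nhds_zero.comp
      (tendsto_natCast_atTop_atTop.atTop_mul_const hδ)).const_mul 12
    simpa using this
  obtain ⟨N₃, h₃⟩ := Filter.eventually_atTop.1
    (hlim.eventually_le_const (show 0 < ε / 2 by positivity))
  refine ⟨max N₁ (max N₂ N₃), fun n hn => ?_⟩
  rw [max_le_iff, max_le_iff] at hn
  have h₃n := h₃ n hn.2.2
  set K := ⌈Real.exp (n * R₀)⌉₊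
  set L := ⌈Real.exp (n * R₁)⌉₊
  have hK : (K : ℝ) ≤ 2 * Real.exp (n * R₀) := ceil_exp_le (by positivity)
  have hL : (L : ℝ) ≤ 2 * Real.exp (n * R₁) := ceil_exp_le (by positivity)
  refine ⟨K, L, exp_le_ceil_exp _, exp_le_ceil_exp _, ?_⟩
  obtain ⟨c, hc⟩ := exists_superposition_code_iid (ι := Fin K) (ι' := Fin L) (n := n) s
    (a := ∑ v, Q v * Real.log (A v)) (δ := δ) (F₀ := F₀) (F₁ := F₁) (η₀ := ε / 8) hQ hQ1 hA hg hw0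
    hw (by convert hQU) (by convert hS) hD0 hD
    (by
      refine le_trans (le_of_eq ?_) (h₁ n hn.1)
      refine Finset.sum_congr rfl fun b _ => ?_
      split_ifs <;> simp)
    (by convert h₂ n hn.2.1)
  refine ⟨c, ?_⟩
  have hfin : 4 * (ε / 8) + L * (2 * Real.exp (n * (3 * δ - F₁))) +
      K * (2 * (√(2 * L) * Real.exp (n * (2 * δ - F₀)))) ≤ ε := by
    have e1 : Real.exp (n * R₁) * Real.exp (n * (3 * δ - F₁)) ≤ Real.exp (-(n * δ)) := by
      rw [← Real.exp_add, Real.exp_le_exp]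
      nlinarith [(Nat.cast_nonneg n : (0 : ℝ) ≤ n)]
    have e2 : Real.exp (n * R₀) * (Real.exp (n * R₁ / 2) * Real.exp (n * (2 * δ - F₀))) ≤
        Real.exp (-(n * δ)) := by
      rw [← Real.exp_add, ← Real.exp_add, Real.exp_le_exp]
      nlinarith [(Nat.cast_nonneg n : (0 : ℝ) ≤ n)]
    have e3 : √(2 * L) ≤ 2 * Real.exp (n * R₁ / 2) := by
      rw [Real.sqrt_le_left (by positivity), mul_pow, ← Real.exp_nat_mul]
      push_cast
      rw [mul_div_cancel₀ _ two_ne_zero]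
      linarith
    have e4 : L * (2 * Real.exp (n * (3 * δ - F₁))) ≤
        2 * Real.exp (n * R₁) * (2 * Real.exp (n * (3 * δ - F₁))) := by gcongr
    have e5 : K * (2 * (√(2 * L) * Real.exp (n * (2 * δ - F₀)))) ≤
        2 * Real.exp (n * R₀) * (2 * (2 * Real.exp (n * R₁ / 2) * Real.exp (n * (2 * δ - F₀)))) := by
      gcongr
    linarith
  refine le_trans (le_of_eq ?_) (hc.trans ?_)
  · congr!
  · rw [Fintype.card_fin, Fintype.card_fin]
    exact mul_le_mul_of_nonneg_left hfin (by positivity)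

theorem le_log_of_le {r t x lo : ℝ} (k n : ℕ) (h0 : 0 ≤ x) (h1 : x < 1)
    (hr : r * 2 ^ k = (1 + x) / (1 - x))
    (hlo : lo ≤ 2 * ∑ i ∈ Finset.range n, x ^ (2 * i + 1) / (2 * i + 1) - k * 0.6931471808)
    (ht : r ≤ t) : lo ≤ Real.log t := by
  have hpos : 0 < r * 2 ^ k := hr ▸ div_pos (by linarith) (by linarith)
  exact (log_bounds k n h0 h1 hr hlo le_rfl).1.trans
    (Real.log_le_log (pos_of_mul_pos_left hpos (by positivity)) ht)

/-- The joint law of the cloud and channel letters. -/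
noncomputable def inputLaw : Fin 3 → ℝ := ![0.12, 0.73, 0.15]

/-- The channel letter of a superposition letter. -/
def channelLetter : Fin 3 → Fin 2 := ![1, 0, 1]

/-- The cloud letter of a superposition letter. -/
def cloudLetter : Fin 3 → Fin 2 := ![0, 1, 1]

/-- The cost tilting of the superposition letters. -/
noncomputable def costTilt : Fin 3 → ℝ := ![0.5625, 1, 0.43]

/-- The law of the cloud letter. -/
noncomputable def cloudLaw (u : Fin 2) : ℝ := ∑ v, if cloudLetter v = u then inputLaw v else 0

/-- The tilted output weight of a cloud letter. -/
noncomputable def cloudWeight (u : Fin 2) (y : Fin 3) : ℝ :=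
  ∑ v, if cloudLetter v = u then inputLaw v * (costTilt v * q (channelLetter v) y ^ 10) else 0

/-- An upper bound for the total tilted output weight. -/
noncomputable def outputWeight : Fin 3 → ℝ := ![0.9262, 0.8044, 1.7867]

theorem cloudLaw_zero : cloudLaw 0 = 0.12 := by
  simp [cloudLaw, Fin.sum_univ_three, cloudLetter, inputLaw]

theorem cloudLaw_one : cloudLaw 1 = 0.88 := by
  simp [cloudLaw, Fin.sum_univ_three, cloudLetter, inputLaw]
  norm_num

theorem cloudWeight_zero (y : Fin 3) : cloudWeight 0 y = 0.12 * (0.5625 * q 1 y ^ 10) := by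
  simp [cloudWeight, Fin.sum_univ_three, cloudLetter, inputLaw, costTilt, channelLetter]

theorem cloudWeight_one (y : Fin 3) : cloudWeight 1 y = 0.73 + 0.15 * (0.43 * q 1 y ^ 10) := by
  have : q 0 y = 1 := by fin_cases y <;> simp [q]
  simp [cloudWeight, Fin.sum_univ_three, cloudLetter, inputLaw, costTilt, channelLetter, this]

theorem q_pos (x : Fin 2) (y : Fin 3) : 0 < q x y := by
  fin_cases x <;> fin_cases y <;> norm_num [q]

theorem sum_sqrt_cloudLaw_mul_cloudWeight_le (y : Fin 3) :
    ∑ u, √(cloudLaw u * cloudWeight u y) ≤ outputWeight y := by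
  rw [Fin.sum_univ_two, cloudLaw_zero, cloudLaw_one, cloudWeight_zero, cloudWeight_one]
  have h0 : √(0.12 * (0.12 * (0.5625 * q 1 y ^ 10))) = 0.09 * q 1 y ^ 5 := by
    rw [Real.sqrt_eq_iff_mul_self_eq (by have := q_pos 1 y; positivity)
      (by have := q_pos 1 y; positivity)]
    ring
  have h1 : √(0.88 * (0.73 + 0.15 * (0.43 * q 1 y ^ 10))) ≤ outputWeight y - 0.09 * q 1 y ^ 5 := by
    rw [Real.sqrt_le_iff]
    fin_cases y <;> norm_num [q, outputWeight]
  linarith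

theorem le_sqrt_costTilt_mul (v y : Fin 3) :
    (![0.75, 1, 0.6557] : Fin 3 → ℝ) v * q (channelLetter v) y ^ 5 ≤
      √(costTilt v * q (channelLetter v) y ^ 10) := by
  refine Real.le_sqrt_of_sq_le ?_
  have h : (![0.75, 1, 0.6557] : Fin 3 → ℝ) v ^ 2 ≤ costTilt v := by
    fin_cases v <;> norm_num [costTilt]
  calc _ = (![0.75, 1, 0.6557] : Fin 3 → ℝ) v ^ 2 * q (channelLetter v) y ^ 10 := by ring
    _ ≤ _ := mul_le_mul_of_nonneg_right h (pow_nonneg (q_pos _ _).le 10)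

theorem le_log_sqrt_tilt_div (v y : Fin 3) :
    (![![-0.21103, -3.53580, 0.66936], ![0.07665, 0.21764, -0.58039], ![-0.34540, -3.67015, 0.53499]] : Fin 3 → Fin 3 → ℝ) v y ≤
      Real.log (√(costTilt v * q (channelLetter v) y ^ 10) / outputWeight y) := by
  have hD : 0 < outputWeight y := by fin_cases y <;> norm_num [outputWeight]
  refine le_trans ?_ (Real.log_le_log (div_pos (mul_pos ?_ (pow_pos (q_pos _ y) 5)) hD)
    (div_le_div_of_nonneg_right (le_sqrt_costTilt_mul v y) hD.le))
  · fin_cases v <;> fin_cases y <;> simp only [q, channelLetter, outputWeight, Fin.zero_eta,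
      Fin.mk_one, Fin.reduceFinMk, Matrix.cons_val]
    · exact le_log_of_le (r := 0.809760) (x := 968 / 4093) 1 12 (by norm_num) (by norm_num)
        (by norm_num) (by norm_num [Finset.sum_range_succ]) (by norm_num)
    · exact le_log_of_le (r := 0.029136) (x := 13511 / 44761) 6 12 (by norm_num) (by norm_num)
        (by norm_num) (by norm_num [Finset.sum_range_succ]) (by norm_num)
    · exact le_log_of_le (r := 1.953008) (x := 59563 / 184563) 0 12 (by norm_num) (by norm_num)
        (by norm_num) (by norm_num [Finset.sum_range_succ]) (by norm_num)
    · exact le_log_of_le (r := 1.079680) (x := 249 / 6499) 0 12 (by norm_num) (by norm_num)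
        (by norm_num) (by norm_num [Finset.sum_range_succ]) (by norm_num)
    · exact le_log_of_le (r := 1.243162) (x := 121581 / 1121581) 0 12 (by norm_num) (by norm_num)
        (by norm_num) (by norm_num [Finset.sum_range_succ]) (by norm_num)
    · exact le_log_of_le (r := 0.559691) (x := 59691 / 1059691) 1 12 (by norm_num) (by norm_num)
        (by norm_num) (by norm_num [Finset.sum_range_succ]) (by norm_num)
    · exact le_log_of_le (r := 0.707946) (x := 103973 / 603973) 1 12 (by norm_num) (by norm_num)
        (by norm_num) (by norm_num [Finset.sum_range_succ]) (by norm_num)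
    · exact le_log_of_le (r := 0.025473) (x := 4924 / 20549) 6 12 (by norm_num) (by norm_num)
        (by norm_num) (by norm_num [Finset.sum_range_succ]) (by norm_num)
    · exact le_log_of_le (r := 1.707450) (x := 14149 / 54149) 0 12 (by norm_num) (by norm_num)
        (by norm_num) (by norm_num [Finset.sum_range_succ]) (by norm_num)
  · fin_cases v <;> simp <;> norm_num

theorem le_log_satellite_ratio (v y : Fin 3) :
    (![![0.00000, 0.00000, 0.00000], ![0.10219, 0.18678, -0.88219], ![-0.74178, -7.58899, 1.34869]] : Fin 3 → Fin 3 → ℝ) v y ≤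
      Real.log (costTilt v * q (channelLetter v) y ^ 10 * cloudLaw (cloudLetter v) /
        cloudWeight (cloudLetter v) y) := by
  fin_cases v
  · have h : costTilt 0 * q (channelLetter 0) y ^ 10 * cloudLaw (cloudLetter 0) /
        cloudWeight (cloudLetter 0) y = 1 := by
      simp only [cloudLetter, channelLetter, costTilt, Matrix.cons_val, cloudLaw_zero,
        cloudWeight_zero]
      have := q_pos 1 y
      field_simp
    simp only [Fin.zero_eta, h, Real.log_one]
    fin_cases y <;> simp <;> norm_num
  · fin_cases y <;> simp only [q, costTilt, cloudLetter, channelLetter, Fin.zero_eta, Fin.mk_one,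
      Fin.reduceFinMk, Matrix.cons_val, cloudLaw_one, cloudWeight_one]
    · exact le_log_of_le (r := 1.107614) (x := 53807 / 1053807) 0 12 (by norm_num) (by norm_num)
        (by norm_num) (by norm_num [Finset.sum_range_succ]) (by norm_num)
    · exact le_log_of_le (r := 1.205375) (x := 1643 / 17643) 0 12 (by norm_num) (by norm_num)
        (by norm_num) (by norm_num [Finset.sum_range_succ]) (by norm_num)
    · exact le_log_of_le (r := 0.413883) (x := 163883 / 663883) 2 12 (by norm_num) (by norm_num)
        (by norm_num) (by norm_num [Finset.sum_range_succ]) (by norm_num)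
  · fin_cases y <;> simp only [q, costTilt, cloudLetter, channelLetter, Fin.zero_eta, Fin.mk_one,
      Fin.reduceFinMk, Matrix.cons_val, cloudLaw_one, cloudWeight_one]
    · exact le_log_of_le (r := 0.476274) (x := 113137 / 363137) 2 12 (by norm_num) (by norm_num)
        (by norm_num) (by norm_num [Finset.sum_range_succ]) (by norm_num)
    · exact le_log_of_le (r := 0.000506) (x := 567 / 31817) 11 12 (by norm_num) (by norm_num)
        (by norm_num) (by norm_num [Finset.sum_range_succ]) (by norm_num)
    · exact le_log_of_le (r := 3.852435) (x := 570487 / 970487) 0 12 (by norm_num) (by norm_num)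
        (by norm_num) (by norm_num [Finset.sum_range_succ]) (by norm_num)

theorem inputLaw_pos (v : Fin 3) : 0 < inputLaw v := by
  fin_cases v <;> norm_num [inputLaw]

theorem W_nonneg (x : Fin 2) (y : Fin 3) : 0 ≤ W x y := by
  fin_cases x <;> fin_cases y <;> norm_num [W]

theorem cloud_rate_lt : (0.025 : ℝ) + 0.113 / 2 < ∑ v, ∑ y, inputLaw v * W (channelLetter v) y *
    Real.log (√(costTilt v * q (channelLetter v) y ^ 10) / outputWeight y) := by
  refine lt_of_lt_of_le ?_ (Finset.sum_le_sum fun v _ => Finset.sum_le_sum fun y _ =>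
    mul_le_mul_of_nonneg_left (le_log_sqrt_tilt_div v y)
      (mul_nonneg (inputLaw_pos v).le (W_nonneg _ _)))
  simp [Fin.sum_univ_three, inputLaw, channelLetter, W]
  norm_num

theorem satellite_rate_lt : (0.113 : ℝ) < ∑ v, ∑ y, inputLaw v * W (channelLetter v) y *
    Real.log (costTilt v * q (channelLetter v) y ^ 10 * cloudLaw (cloudLetter v) /
        cloudWeight (cloudLetter v) y) := by
  refine lt_of_lt_of_le ?_ (Finset.sum_le_sum fun v _ => Finset.sum_le_sum fun y _ =>
    mul_le_mul_of_nonneg_left (le_log_satellite_ratio v y)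
      (mul_nonneg (inputLaw_pos v).le (W_nonneg _ _)))
  simp [Fin.sum_univ_three, inputLaw, channelLetter, W]
  norm_num

/-- The rate `0.138` is achievable by superposition coding. -/
theorem exists_code_pe_le {ε : ℝ} (hε : 0 < ε) : ∃ N : ℕ, ∀ n : ℕ, N ≤ n →
    ∃ M : ℕ, ∃ c : Fin M → Fin n → Fin 2, Real.exp (n * 0.138) ≤ M ∧ pe n M c ≤ ε := by
  obtain ⟨N, hN⟩ := exists_superposition_code_of_rates (Q := inputLaw) (A := costTilt)
    (w := fun v y => W (channelLetter v) y) (g := fun v y => q (channelLetter v) y)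
    (um := cloudLetter) (QU := cloudLaw) (S := cloudWeight) (D := outputWeight) 10
    (R₀ := 0.025) (R₁ := 0.113) inputLaw_pos
    (by simp [Fin.sum_univ_three, inputLaw]; norm_num)
    (fun v => by fin_cases v <;> norm_num [costTilt])
    (fun v y => q_pos _ _) (fun v y => W_nonneg _ _)
    (fun v => by fin_cases v <;> simp [Fin.sum_univ_three, channelLetter, W] <;> norm_num)
    (fun u => rfl) (fun u y => rfl) (fun y => by fin_cases y <;> norm_num [outputWeight])
    sum_sqrt_cloudLaw_mul_cloudWeight_le (by norm_num) (by norm_num) cloud_rate_lt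
    satellite_rate_lt hε
  refine ⟨N, fun n hn => ?_⟩
  obtain ⟨K, L, hK, hL, c, hc⟩ := hN n hn
  refine ⟨K * L, fun m i => channelLetter (c (finProdFinEquiv.symm m).1
    (finProdFinEquiv.symm m).2 i), ?_, ?_⟩
  · rw [Nat.cast_mul]
    refine le_trans (le_of_eq ?_) (mul_le_mul hK hL (Real.exp_pos _).le (Nat.cast_nonneg K))
    rw [← Real.exp_add]
    ring_nf
  · have hKL : (0 : ℝ) < K * L :=
      mul_pos ((Real.exp_pos _).trans_le hK) ((Real.exp_pos _).trans_le hL)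
    unfold pe
    rw [Nat.cast_mul, one_div, ← div_eq_inv_mul, div_le_iff₀ hKL, mul_comm ε]
    refine le_trans (le_of_eq ?_) hc
    rw [← finProdFinEquiv.sum_comp, Fintype.sum_prod_type]
    refine Finset.sum_congr rfl fun k _ => Finset.sum_congr rfl fun l _ =>
      Finset.sum_congr rfl fun y _ => ?_
    simp only [Wn, qn, Equiv.symm_apply_apply]
    congr 1
    refine if_congr ?_ rfl rfl
    rw [finProdFinEquiv.symm.exists_congr_left]
    simp

/-- Counter-example: the rate `0.137998` is achievable for `(W,q)` under mismatched decoding,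
while the LM rate satisfies `I_LM(Q) ≤ 0.1369` for every input distribution `Q`;
hence `C_M ≥ 0.137998 > 0.1369 ≥ C_LM`. -/
theorem counterexample_to_mismatched_converse :
    (∀ δ : ℝ, 0 < δ → ∀ ε : ℝ, 0 < ε → ∃ N : ℕ, ∀ n : ℕ, N ≤ n →
      ∃ M : ℕ, ∃ c : Fin M → Fin n → Fin 2,
        Real.exp (n * (0.137998 - δ)) ≤ (M : ℝ) ∧ pe n M c ≤ ε) ∧
    (∀ Q : Fin 2 → ℝ, (∀ x, 0 ≤ Q x) → (∑ x, Q x) = 1 → ILM Q ≤ 0.1369) := by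
  refine ⟨fun δ hδ ε hε => ?_, fun Q h0 h1 => ILM_le h0 h1⟩
  obtain ⟨N, hN⟩ := exists_code_pe_le hε
  refine ⟨N, fun n hn => ?_⟩
  obtain ⟨M, c, hM, hc⟩ := hN n hn
  refine ⟨M, c, le_trans (Real.exp_le_exp.2 ?_) hM, hc⟩
  exact mul_le_mul_of_nonneg_left (by linarith) (Nat.cast_nonneg n)
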